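/- Let M be a weight sequence satisfying (M.2) and (M.2)*, and let A be a weight sequence satisfying (M.2) and p! ⊂ A. Then 𝒦^{{M}}(ℝ^d) ∗ 𝒮^{{M}}_{{A}}(ℝ^d) = 𝒮^{{M}}_{{A}}(ℝ^d) ∗ 𝒮^{{M}}_{{A}}(ℝ^d) = 𝒮^{{M}}_{{A}}(ℝ^d); in particular, for every φ ∈ 𝒮^{{M}}_{{A}}(ℝ^d) there exist ψ ∈ 𝒦^{{M}}(ℝ^d) and χ ∈ 𝒮^{{M}}_{{A}}(ℝ^d) with φ = ψ ∗ χ, and conversely every such convolution lies in 𝒮^{{M}}_{{A}}(ℝ^d). Moreover, for every set B ⊆ 𝒮^{{M}}_{{A}}(ℝ^d) that is bounded in 𝒮^{{M}}_{{A}}(ℝ^d) (i.e., there is h > 0 with sup_{φ∈B} ‖φ‖_{𝒮^{M,h}_{A,h}} < ∞) there exist ψ ∈ 𝒦^{{M}}(ℝ^d) and a bounded set A' ⊆ 𝒮^{{M}}_{{A}}(ℝ^d) with ψ ∗ A' = B. -/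

import Mathlib

open Filter MeasureTheory
open scoped BigOperators

noncomputable section

abbrev Rd (d : ℕ) := EuclideanSpace ℝ (Fin d)

/-- Partial derivative in the `j`-th coordinate direction. -/
def dop {d : ℕ} {E : Type*} [NormedAddCommGroup E] [NormedSpace ℝ E]
    (j : Fin d) (f : Rd d → E) : Rd d → E :=
  fun x => fderiv ℝ f x (EuclideanSpace.single j (1:ℝ))

/-- Iterated partial derivative `∂^α` for a multi-index `α : Fin d → ℕ`. -/
def pD {d : ℕ} {E : Type*} [NormedAddCommGroup E] [NormedSpace ℝ E]
    (α : Fin d → ℕ) (f : Rd d → E) : Rd d → E :=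
  (List.finRange d).foldr (fun j g => (dop j)^[α j] g) f

/-- Length `|α|` of a multi-index. -/
def msize {d : ℕ} (α : Fin d → ℕ) : ℕ := ∑ j, α j

/-- `M` is a weight sequence: positive, normalized, `M_p^{1/p} → ∞`, log-convex. -/
def IsWeightSeq (M : ℕ → ℝ) : Prop :=
  (∀ p, 0 < M p) ∧ M 0 = 1 ∧ M 1 = 1 ∧
  Tendsto (fun p : ℕ => (M p) ^ ((p : ℝ)⁻¹)) atTop atTop ∧
  ∀ p : ℕ, 1 ≤ p → (M p)^2 ≤ M (p-1) * M (p+1)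

/-- Condition (M.2) with explicit constants `C₀, H ≥ 1`. -/
def HasM2 (M : ℕ → ℝ) (C₀ H : ℝ) : Prop :=
  1 ≤ C₀ ∧ 1 ≤ H ∧ ∀ p q : ℕ, M (p+q) ≤ C₀ * H^(p+q) * M p * M q

/-- Condition (M.2). -/
def M2 (M : ℕ → ℝ) : Prop := ∃ C₀ H, HasM2 M C₀ H

/-- Condition (M.2)*: `2 m_p ≤ m_{Np}` for `p ≥ p₀`. -/
def M2star (M : ℕ → ℝ) : Prop :=
  ∃ p₀ N : ℕ, 0 < p₀ ∧ 0 < N ∧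
    ∀ p, p₀ ≤ p → 2 * (M p / M (p-1)) ≤ M (N*p) / M (N*p - 1)

/-- Associated function `ν_M(t) = sup_p log(t^p / M_p)`. -/
def nuA (M : ℕ → ℝ) (t : ℝ) : ℝ := ⨆ p : ℕ, Real.log (t ^ p / M p)

/-- `φ ∈ 𝒦^{(M)}(ℝ^d)` (Beurling type). -/
def KBeu (d : ℕ) (M : ℕ → ℝ) (φ : Rd d → ℂ) : Prop :=
  ContDiff ℝ (⊤ : ℕ∞) φ ∧ ∀ k : ℝ, 0 < k → ∀ n : ℕ, ∃ C : ℝ,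
    ∀ (α : Fin d → ℕ) (x : Rd d),
      k ^ msize α * ‖pD α φ x‖ * Real.exp ((n : ℝ) * ‖x‖) ≤ C * M (msize α)

/-- `φ ∈ 𝒦^{{M}}(ℝ^d)` (Roumieu type). -/
def KRou (d : ℕ) (M : ℕ → ℝ) (φ : Rd d → ℂ) : Prop :=
  ContDiff ℝ (⊤ : ℕ∞) φ ∧ ∃ k : ℝ, 0 < k ∧ ∀ n : ℕ, ∃ C : ℝ,
    ∀ (α : Fin d → ℕ) (x : Rd d),
      k ^ msize α * ‖pD α φ x‖ * Real.exp ((n : ℝ) * ‖x‖) ≤ C * M (msize α)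

/-- Convolution `(ψ ∗ χ)(x) = ∫ ψ(t) χ(x - t) dt`. -/
def convF {d : ℕ} (ψ χ : Rd d → ℂ) : Rd d → ℂ := fun x => ∫ t : Rd d, ψ t * χ (x - t)

/-- The set of all convolutions `ψ ∗ χ` with `ψ ∈ X`, `χ ∈ Y`. -/
def convSet {d : ℕ} (X Y : Set (Rd d → ℂ)) : Set (Rd d → ℂ) :=
  {f | ∃ ψ ∈ X, ∃ χ ∈ Y, f = convF ψ χ}

/-- The relation `p! ⊂ A`: `p! ≤ C L^p A_p`. -/
def factSubset (A : ℕ → ℝ) : Prop :=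
  ∃ C L : ℝ, 1 ≤ C ∧ 1 ≤ L ∧ ∀ p : ℕ, (p.factorial : ℝ) ≤ C * L ^ p * A p

/-- `φ ∈ 𝒮^{{M}}_{{A}}(ℝ^d)` (Gelfand–Shilov space of Roumieu type). -/
def GSRou (d : ℕ) (M A : ℕ → ℝ) (φ : Rd d → ℂ) : Prop :=
  ContDiff ℝ (⊤ : ℕ∞) φ ∧ ∃ h : ℝ, 0 < h ∧ ∃ C : ℝ,
    ∀ (α : Fin d → ℕ) (x : Rd d),
      h ^ msize α * ‖pD α φ x‖ * Real.exp (nuA A (h * ‖x‖)) ≤ C * M (msize α)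

/-- Bounded subset of `𝒮^{{M}}_{{A}}(ℝ^d)`. -/
def GSRouBdd (d : ℕ) (M A : ℕ → ℝ) (B : Set (Rd d → ℂ)) : Prop :=
  (∀ φ ∈ B, GSRou d M A φ) ∧ ∃ h : ℝ, 0 < h ∧ ∃ C : ℝ,
    ∀ φ ∈ B, ∀ (α : Fin d → ℕ) (x : Rd d),
      h ^ msize α * ‖pD α φ x‖ * Real.exp (nuA A (h * ‖x‖)) ≤ C * M (msize α)

section Weights

variable {M : ℕ → ℝ}

lemma IsWeightSeq.pos (hM : IsWeightSeq M) (p : ℕ) : 0 < M p := hM.1 p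

lemma IsWeightSeq.bddAbove_log (hM : IsWeightSeq M) {t : ℝ} (ht : 0 ≤ t) :
    BddAbove (Set.range fun p : ℕ => Real.log (t ^ p / M p)) := by
  apply Filter.IsBoundedUnder.bddAbove_range
  refine ⟨0, ?_⟩
  rw [eventually_map]
  filter_upwards [hM.2.2.2.1.eventually_ge_atTop (t + 1), eventually_ge_atTop 1] with p hp hp1
  have h0 : (p : ℝ) ≠ 0 := by positivity
  have h1 : (t + 1) ^ p ≤ M p := by
    calc (t + 1) ^ p ≤ (M p ^ ((p : ℝ)⁻¹)) ^ p := by gcongr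
      _ = M p := by
        rw [← Real.rpow_natCast, ← Real.rpow_mul (hM.pos p).le, inv_mul_cancel₀ h0, Real.rpow_one]
  apply Real.log_nonpos
  · have := hM.pos p
    positivity
  · rw [div_le_one (hM.pos p)]
    exact (pow_le_pow_left₀ ht (by linarith) p).trans h1

lemma IsWeightSeq.pow_le (hM : IsWeightSeq M) {t : ℝ} (ht : 0 ≤ t) (p : ℕ) :
    t ^ p ≤ M p * Real.exp (nuA M t) := by
  have hp := hM.pos p
  rcases ht.eq_or_lt with rfl | ht'
  · rcases p.eq_zero_or_pos with rfl | hp0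
    · have h := le_ciSup (hM.bddAbove_log le_rfl) 0
      simp only [hM.2.1, pow_zero, div_one, Real.log_one] at h
      have h' : 0 ≤ nuA M 0 := h
      simpa [hM.2.1] using h'
    · rw [zero_pow hp0.ne']
      positivity
  · have h := le_ciSup (hM.bddAbove_log ht) p
    have h2 : t ^ p / M p ≤ Real.exp (nuA M t) := by
      rw [← Real.log_le_iff_le_exp (by positivity)]
      exact h
    rw [div_le_iff₀ hp] at h2
    linarith

lemma IsWeightSeq.exp_nuA_le (hM : IsWeightSeq M) {t B : ℝ} (ht : 0 ≤ t)
    (h : ∀ p, t ^ p ≤ B * M p) : Real.exp (nuA M t) ≤ B := by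
  have hB : 1 ≤ B := by simpa [hM.2.1] using h 0
  rw [← Real.le_log_iff_exp_le (by linarith)]
  refine ciSup_le fun p => ?_
  have hp := hM.pos p
  rcases ht.eq_or_lt with rfl | ht'
  · rcases p.eq_zero_or_pos with rfl | hp0
    · simpa [hM.2.1] using Real.log_nonneg hB
    · simpa [zero_pow hp0.ne'] using Real.log_nonneg hB
  · apply Real.log_le_log (by positivity)
    rw [div_le_iff₀ hp]
    exact h p

lemma IsWeightSeq.nuA_mono (hM : IsWeightSeq M) {s t : ℝ} (hs : 0 ≤ s) (hst : s ≤ t) :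
    nuA M s ≤ nuA M t := by
  rw [← Real.exp_le_exp]
  refine hM.exp_nuA_le hs fun p => ?_
  have := hM.pow_le (hs.trans hst) p
  have := pow_le_pow_left₀ hs hst p
  linarith

lemma IsWeightSeq.nuA_nonneg (hM : IsWeightSeq M) {t : ℝ} (ht : 0 ≤ t) : 0 ≤ nuA M t := by
  have := hM.pow_le ht 0
  rw [← Real.exp_le_exp]
  simpa [hM.2.1] using this

lemma IsWeightSeq.ratio_mono (hM : IsWeightSeq M) {p q : ℕ} (hp : 1 ≤ p) (hpq : p ≤ q) :
    M p / M (p - 1) ≤ M q / M (q - 1) := by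
  induction q, hpq using Nat.le_induction with
  | base => exact le_rfl
  | succ q hq ih =>
    refine ih.trans ?_
    have h := hM.2.2.2.2 q (hp.trans hq)
    rw [div_le_div_iff₀ (hM.pos _) (hM.pos _)]
    simp only [Nat.add_sub_cancel]
    nlinarith

lemma IsWeightSeq.one_le_ratio (hM : IsWeightSeq M) {p : ℕ} (hp : 1 ≤ p) :
    1 ≤ M p / M (p - 1) := by
  simpa [hM.2.1, hM.2.2.1] using hM.ratio_mono le_rfl hp

lemma IsWeightSeq.mono (hM : IsWeightSeq M) : Monotone M := by
  refine monotone_nat_of_le_succ fun n => ?_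
  have := hM.one_le_ratio (p := n + 1) (by lia)
  rwa [one_le_div (hM.pos _)] at this

lemma IsWeightSeq.one_le (hM : IsWeightSeq M) (p : ℕ) : 1 ≤ M p := by
  simpa [hM.2.1] using hM.mono p.zero_le

lemma IsWeightSeq.mul_ratio_pow_le (hM : IsWeightSeq M) {n : ℕ} (hn : 1 ≤ n) (k : ℕ) :
    M n * (M n / M (n - 1)) ^ k ≤ M (n + k) := by
  induction k with
  | zero => simp
  | succ k ih =>
    have h := hM.ratio_mono hn (show n ≤ n + (k + 1) by lia)
    have h2 : M (n + (k + 1)) = M (n + k) * (M (n + (k + 1)) / M (n + (k + 1) - 1)) := by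
      rw [show n + (k + 1) - 1 = n + k by lia, mul_div_cancel₀]
      exact (hM.pos _).ne'
    rw [h2, pow_succ, ← mul_assoc]
    have := hM.pos n
    have := hM.pos (n - 1)
    gcongr
    exact (hM.pos _).le

lemma IsWeightSeq.mul_le (hM : IsWeightSeq M) (p q : ℕ) : M p * M q ≤ M (p + q) := by
  induction q with
  | zero => simp [hM.2.1]
  | succ q ih =>
    rcases Nat.eq_zero_or_pos p with rfl | hp
    · simp [hM.2.1]
    · have h := hM.ratio_mono (show 1 ≤ q + 1 by lia) (show q + 1 ≤ p + (q + 1) by lia)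
      rw [div_le_div_iff₀ (hM.pos _) (hM.pos _), show p + (q + 1) - 1 = p + q by lia,
        show q + 1 - 1 = q by lia] at h
      have h0 := hM.pos q
      have h1 := hM.pos (q + 1)
      have : M p * M (q + 1) * M q ≤ M (p + (q + 1)) * M q := by nlinarith
      exact le_of_mul_le_mul_right this h0

lemma IsWeightSeq.nuA_zero (hM : IsWeightSeq M) : nuA M 0 = 0 := by
  apply le_antisymm _ (hM.nuA_nonneg le_rfl)
  rw [← Real.exp_le_exp, Real.exp_zero]
  refine hM.exp_nuA_le le_rfl fun p => ?_
  rcases p.eq_zero_or_pos with rfl | hp0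
  · simp [hM.2.1]
  · rw [zero_pow hp0.ne', one_mul]
    exact (hM.pos p).le

lemma HasM2.two_mul_nuA_le (hM : IsWeightSeq M) {C₀ H : ℝ} (h : HasM2 M C₀ H) {t : ℝ}
    (ht : 0 ≤ t) : 2 * nuA M t ≤ nuA M (H * t) + Real.log C₀ := by
  obtain ⟨hC, hH, h⟩ := h
  have hE := Real.exp_pos (nuA M (H * t))
  have key : ∀ p q, t ^ p * t ^ q ≤ C₀ * Real.exp (nuA M (H * t)) * M p * M q := by
    intro p q
    have h1 := hM.pow_le (t := H * t) (by positivity) (p + q)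
    have h2 := h p q
    rw [mul_pow] at h1
    have h3 : H ^ (p + q) * (t ^ p * t ^ q) ≤
        H ^ (p + q) * (C₀ * Real.exp (nuA M (H * t)) * M p * M q) := by
      rw [← pow_add]
      nlinarith
    exact le_of_mul_le_mul_left h3 (by positivity)
  have h2 : Real.exp (nuA M t) * Real.exp (nuA M t) ≤ C₀ * Real.exp (nuA M (H * t)) := by
    have hEt := Real.exp_pos (nuA M t)
    rw [← le_div_iff₀ hEt]
    refine hM.exp_nuA_le ht fun p => ?_
    have hp := hM.pos p
    rw [div_mul_eq_mul_div, le_div_iff₀ hEt]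
    rcases ht.eq_or_lt with rfl | ht'
    · have := key p 0
      rw [hM.nuA_zero, Real.exp_zero, mul_one]
      simpa [hM.2.1] using this
    · rw [← le_div_iff₀' (by positivity)]
      refine hM.exp_nuA_le ht fun q => ?_
      rw [div_mul_eq_mul_div, le_div_iff₀' (by positivity)]
      exact key p q
  rw [← Real.exp_le_exp, Real.exp_add, Real.exp_log (by linarith), two_mul, Real.exp_add]
  linarith

/-- Under (M.2), rescaling the argument makes the associated function arbitrarily small relative to
itself. -/
lemma M2.nuA_div_le (hM : IsWeightSeq M) (h : M2 M) {l : ℝ} (hl : 0 < l) :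
    ∃ K C : ℝ, 1 ≤ K ∧ ∀ t, 0 ≤ t → nuA M (t / K) ≤ l * nuA M t + C := by
  obtain ⟨C₀, H, h⟩ := h
  have hC := h.1
  have hH := h.2.1
  have key : ∀ k : ℕ, ∀ t, 0 ≤ t → 2 ^ k * nuA M (t / H ^ k) ≤ nuA M t + 2 ^ k * Real.log C₀ := by
    intro k
    induction k with
    | zero => intro t ht; simpa using Real.log_nonneg hC
    | succ k ih =>
      intro t ht
      have h1 := h.two_mul_nuA_le hM (t := t / H ^ (k + 1)) (by positivity)
      have h2 : H * (t / H ^ (k + 1)) = t / H ^ k := by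
        rw [pow_succ]; field_simp
      rw [h2] at h1
      have h3 := ih t ht
      have h4 : 2 ^ k * (2 * nuA M (t / H ^ (k + 1))) ≤
        2 ^ k * (nuA M (t / H ^ k) + Real.log C₀) := by gcongr
      rw [pow_succ]
      linarith
  obtain ⟨k, hk⟩ := pow_unbounded_of_one_lt (1 / l) (one_lt_two)
  refine ⟨H ^ k, Real.log C₀, one_le_pow₀ hH, fun t ht => ?_⟩
  have h1 := key k t ht
  have h2 := hM.nuA_nonneg ht
  have h3 : 1 < 2 ^ k * l := by rwa [div_lt_iff₀ hl] at hk
  have h4 : (2:ℝ) ^ k * nuA M (t / H ^ k) ≤ 2 ^ k * (l * nuA M t + Real.log C₀) := by nlinarith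
  exact le_of_mul_le_mul_left h4 (by positivity)

lemma M2.exists_pow_mul_exp_le (hM : IsWeightSeq M) (h : M2 M) {l : ℝ} (hl : 0 < l) (p : ℕ) :
    ∃ C : ℝ, 0 < C ∧ ∀ t, 0 ≤ t → (1 + t) ^ p * Real.exp (-(l * nuA M t)) ≤ C := by
  obtain ⟨K, C, hK, hKC⟩ := h.nuA_div_le hM hl
  refine ⟨(2 * K) ^ p * M p * Real.exp C, by have := hM.pos p; positivity, fun t ht => ?_⟩
  have h1 := hM.pow_le (t := t / K) (by positivity) p
  have h3 : Real.exp (nuA M (t / K)) ≤ Real.exp (l * nuA M t) * Real.exp C := by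
    rw [← Real.exp_add, Real.exp_le_exp]
    exact hKC t ht
  have h0 := hM.one_le p
  have h2 : (1 + t) ^ p ≤ (2 * K) ^ p * (M p * Real.exp (nuA M (t / K))) := by
    have hE : 1 ≤ Real.exp (nuA M (t / K)) := Real.one_le_exp (hM.nuA_nonneg (by positivity))
    rcases le_total t 1 with h | h
    · calc (1 + t) ^ p ≤ (2 * K) ^ p := by gcongr; linarith
        _ ≤ _ := le_mul_of_one_le_right (by positivity) (by nlinarith)
    · calc (1 + t) ^ p ≤ (2 * K * (t / K)) ^ p := by
            gcongr
            rw [mul_assoc, mul_div_cancel₀ _ (by positivity)]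
            linarith
        _ = (2 * K) ^ p * (t / K) ^ p := by rw [mul_pow]
        _ ≤ _ := by gcongr
  rw [Real.exp_neg, ← div_eq_mul_inv, div_le_iff₀ (Real.exp_pos _)]
  calc (1 + t) ^ p ≤ (2 * K) ^ p * (M p * Real.exp (nuA M (t / K))) := h2
    _ ≤ (2 * K) ^ p * (M p * (Real.exp (l * nuA M t) * Real.exp C)) := by gcongr
    _ = _ := by ring

lemma M2star.nuA_two_mul_le (hM : IsWeightSeq M) (h : M2star M) :
    ∃ L C : ℝ, 1 ≤ L ∧ 0 ≤ C ∧ ∀ t, 0 ≤ t → nuA M (2 * t) ≤ L * nuA M t + C := by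
  obtain ⟨p₀, N, hp₀, hN, h⟩ := h
  set r : ℕ → ℝ := fun q => M (N * q) / (2 ^ q * M (q - 1)) ^ N with hr
  have hden : ∀ q, 0 < (2 ^ q * M (q - 1)) ^ N := fun q => by
    have := hM.pos (q - 1); positivity
  have hrpos : ∀ q, 0 < r q := fun q => div_pos (hM.pos _) (hden q)
  have hrmono : ∀ q, p₀ ≤ q → r p₀ ≤ r q := by
    intro q hq
    induction q, hq using Nat.le_induction with
    | base => exact le_rfl
    | succ q hq ih =>
      refine ih.trans ?_
      rw [hr]
      simp only [Nat.add_sub_cancel]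
      have h1 := h q hq
      have h2 := hM.mul_ratio_pow_le (n := N * q) (by nlinarith) N
      have hq1 := hM.pos (q - 1)
      have hq2 := hM.pos q
      have h3 : M (N * q) * (2 * (M q / M (q - 1))) ^ N ≤ M (N * (q + 1)) := by
        refine le_trans ?_ h2
        have := hM.pos (N * q)
        gcongr
      rw [div_le_div_iff₀ (by positivity) (by positivity)]
      calc M (N * q) * (2 ^ (q + 1) * M q) ^ N
          = M (N * q) * (2 * (M q / M (q - 1))) ^ N * (2 ^ q * M (q - 1)) ^ N := by
            rw [mul_assoc, ← mul_pow]
            congr 2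
            field_simp
            ring
        _ ≤ _ := by gcongr
  have hc := hrpos p₀
  set c := r p₀
  have hlow : ∀ q, p₀ ≤ q → c * (2 ^ q * M (q - 1)) ^ N ≤ M (N * q) := by
    intro q hq
    have := hrmono q hq
    rwa [hr, le_div_iff₀ (hden q)] at this
  set D : ℝ := 2 ^ N / c + 2 ^ (N * p₀) + Real.exp (nuA M 2) with hD
  have hD1 : 1 ≤ D := by
    have : 1 ≤ Real.exp (nuA M 2) := Real.one_le_exp (hM.nuA_nonneg (by norm_num))
    have : 0 < (2:ℝ) ^ N / c := by positivity
    have : (0:ℝ) < 2 ^ (N * p₀) := by positivity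
    linarith
  refine ⟨(3 * N + N * p₀ : ℕ), Real.log D, ?_, Real.log_nonneg hD1, fun t ht => ?_⟩
  · norm_cast; nlinarith
  rw [← Real.exp_le_exp, Real.exp_add, Real.exp_log (by linarith), mul_comm _ (nuA M t),
    Real.exp_mul, Real.rpow_natCast]
  set E := Real.exp (nuA M t) with hE
  have hE1 : 1 ≤ E := Real.one_le_exp (hM.nuA_nonneg ht)
  have h2N : 0 < (2:ℝ) ^ N / c := by positivity
  have h2p : (0:ℝ) < 2 ^ (N * p₀) := by positivity
  have he2 := Real.exp_pos (nuA M 2)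
  rcases le_total t 1 with ht1 | ht1
  · calc Real.exp (nuA M (2 * t)) ≤ Real.exp (nuA M 2) := by
          rw [Real.exp_le_exp]; exact hM.nuA_mono (by positivity) (by linarith)
      _ ≤ D := by linarith
      _ ≤ _ := le_mul_of_one_le_left (by linarith) (one_le_pow₀ hE1)
  have htE : t ≤ E := by simpa [hM.2.2.1] using hM.pow_le ht 1
  refine hM.exp_nuA_le (by positivity) fun p => ?_
  rcases lt_or_ge p (N * p₀) with hp | hp
  · calc (2 * t) ^ p ≤ (2 * t) ^ (N * p₀) := pow_le_pow_right₀ (by linarith) hp.le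
      _ = 2 ^ (N * p₀) * t ^ (N * p₀) := by rw [mul_pow]
      _ ≤ D * E ^ (3 * N + N * p₀) := by
        gcongr
        · linarith
        · calc t ^ (N * p₀) ≤ E ^ (N * p₀) := by gcongr
            _ ≤ _ := pow_le_pow_right₀ hE1 (by lia)
      _ ≤ _ := by
        rw [mul_comm D]
        exact le_mul_of_one_le_right (by positivity) (hM.one_le p)
  · set q := p / N with hq
    have hqp : p₀ ≤ q := (Nat.le_div_iff_mul_le hN).2 (by linarith [mul_comm N p₀])
    have hpq : p = N * q + p % N := (Nat.div_add_mod p N).symm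
    have hmod : p % N < N := Nat.mod_lt _ hN
    have hq1 := hM.pos (q - 1)
    have hqE := hM.pow_le ht (q - 1)
    have e1 : t ^ (N * q) = t ^ N * (t ^ (q - 1)) ^ N := by
      rw [← pow_mul, ← pow_add]
      congr 1
      obtain ⟨q', hq'⟩ : ∃ q', q = q' + 1 := ⟨q - 1, by lia⟩
      rw [hq', Nat.add_sub_cancel]; ring
    have e2 : c * (2 ^ (N * q) * M (q - 1) ^ N) ≤ M p := by
      have := hlow q hqp
      rw [mul_pow, ← pow_mul, mul_comm q N] at this
      exact this.trans (hM.mono (by lia))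
    calc (2 * t) ^ p ≤ (2 * t) ^ (N * q + N) := pow_le_pow_right₀ (by linarith) (by lia)
      _ = 2 ^ N * t ^ N * 2 ^ (N * q) * (t ^ N * (t ^ (q - 1)) ^ N) := by
        rw [← e1]; ring
      _ ≤ 2 ^ N * E ^ N * 2 ^ (N * q) * (E ^ N * (M (q - 1) * E) ^ N) := by gcongr
      _ = (2 ^ N / c) * E ^ (3 * N) * (c * (2 ^ (N * q) * M (q - 1) ^ N)) := by
        field_simp; ring
      _ ≤ D * E ^ (3 * N + N * p₀) * M p := by
        refine mul_le_mul (mul_le_mul ?_ ?_ (by positivity) (by linarith)) e2 (by positivity)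
          (by positivity)
        · linarith
        · exact pow_le_pow_right₀ hE1 (by lia)
      _ = _ := by ring

/-- Under (M.2)*, rescaling the argument changes the associated function by a bounded factor. -/
lemma M2star.le_nuA_div (hM : IsWeightSeq M) (h : M2star M) {K : ℝ} (hK : 1 ≤ K) :
    ∃ l C : ℝ, 0 < l ∧ ∀ t, 0 ≤ t → l * nuA M t ≤ nuA M (t / K) + C := by
  obtain ⟨L, C, hL, hC, h⟩ := h.nuA_two_mul_le hM
  have key : ∀ k : ℕ, ∃ D : ℝ, ∀ t, 0 ≤ t → nuA M (2 ^ k * t) ≤ L ^ k * nuA M t + D := by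
    intro k
    induction k with
    | zero => exact ⟨0, fun t _ => by simp⟩
    | succ k ih =>
      obtain ⟨D, hD⟩ := ih
      refine ⟨L * D + C, fun t ht => ?_⟩
      have h1 := h (2 ^ k * t) (by positivity)
      have h2 := mul_le_mul_of_nonneg_left (hD t ht) (by linarith : 0 ≤ L)
      rw [pow_succ', mul_assoc, pow_succ']
      linarith
  obtain ⟨k, hk⟩ := pow_unbounded_of_one_lt K (one_lt_two)
  obtain ⟨D, hD⟩ := key k
  refine ⟨(L ^ k)⁻¹, D / L ^ k, by positivity, fun t ht => ?_⟩
  have h1 := hD (t / K) (by positivity)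
  have h2 : nuA M t ≤ nuA M (2 ^ k * (t / K)) := by
    apply hM.nuA_mono ht
    rw [← mul_div_assoc, le_div_iff₀ (by positivity)]
    nlinarith
  have h3 : 0 < L ^ k := by positivity
  rw [inv_mul_le_iff₀ h3, mul_add, mul_div_cancel₀ _ h3.ne']
  linarith

end Weights

section SlowVariation

variable {M : ℕ → ℝ}

lemma IsWeightSeq.log_le_nuA (hM : IsWeightSeq M) {t : ℝ} (ht : 0 < t) (p : ℕ) :
    p * Real.log t - Real.log (M p) ≤ nuA M t := by
  have h := le_ciSup (hM.bddAbove_log ht.le) p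
  rw [Real.log_div (by positivity) (hM.pos p).ne', Real.log_pow] at h
  exact h

lemma IsWeightSeq.nuA_le (hM : IsWeightSeq M) {t B : ℝ} (ht : 0 < t)
    (h : ∀ p : ℕ, p * Real.log t - Real.log (M p) ≤ B) : nuA M t ≤ B := by
  refine ciSup_le fun p => ?_
  rw [Real.log_div (by positivity) (hM.pos p).ne', Real.log_pow]
  exact h p

lemma IsWeightSeq.nuA_le_of_le_two_mul (hM : IsWeightSeq M) {a b : ℝ} (ha : 0 < a) (hab : a ≤ b)
    (hb : b ≤ 2 * a) : nuA M b ≤ nuA M a + 2 * ((b - a) / a) * nuA M (2 * a) := by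
  have hb0 : 0 < b := ha.trans_le hab
  set δ := (Real.log b - Real.log a) / Real.log 2 with hδ
  have hl2 : 0 < Real.log 2 := Real.log_pos (by norm_num)
  have hl2' : 1 / 2 < Real.log 2 := by linarith [Real.log_two_gt_d9]
  have e1 : Real.log b = Real.log a + δ * Real.log 2 := by
    rw [hδ, div_mul_cancel₀ _ hl2.ne']; ring
  have e2 : Real.log (2 * a) = Real.log 2 + Real.log a := Real.log_mul (by norm_num) ha.ne'
  have h0 : 0 ≤ δ := div_nonneg (sub_nonneg.2 (Real.log_le_log ha hab)) hl2.le
  have h1 : δ ≤ 1 := by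
    rw [hδ, div_le_one hl2]
    have := Real.log_le_log hb0 hb
    linarith
  have h2 : δ ≤ 2 * ((b - a) / a) := by
    rw [hδ, div_le_iff₀ hl2]
    have h3 : Real.log b - Real.log a ≤ (b - a) / a := by
      rw [← Real.log_div hb0.ne' ha.ne']
      have := Real.log_le_sub_one_of_pos (div_pos hb0 ha)
      rw [sub_div, div_self ha.ne']
      exact this
    have h4 : 0 ≤ (b - a) / a := div_nonneg (by linarith) ha.le
    nlinarith
  have n1 := hM.nuA_nonneg ha.le
  have n2 := hM.nuA_nonneg (t := 2 * a) (by positivity)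
  refine (hM.nuA_le (B := nuA M a + δ * nuA M (2 * a)) hb0 fun p => ?_).trans (by gcongr)
  have k1 := hM.log_le_nuA ha p
  have k2 := hM.log_le_nuA (t := 2 * a) (by positivity) p
  have : p * Real.log b - Real.log (M p) = (1 - δ) * (p * Real.log a - Real.log (M p)) +
      δ * (p * Real.log (2 * a) - Real.log (M p)) := by
    rw [e1, e2]; ring
  rw [this]
  nlinarith

lemma M2star.nuA_le_pow (hM : IsWeightSeq M) (h : M2star M) :
    ∃ (D : ℝ) (m : ℕ), 0 ≤ D ∧ ∀ t, 0 ≤ t → nuA M t ≤ D * (1 + t) ^ m := by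
  obtain ⟨L, C, hL, hC, h⟩ := h.nuA_two_mul_le hM
  obtain ⟨m, hm⟩ := pow_unbounded_of_one_lt (L + 1) (show (1:ℝ) < 4 / 3 by norm_num)
  set D := C + nuA M 1
  have hn1 := hM.nuA_nonneg (zero_le_one)
  have hD : 0 ≤ D := by positivity
  have key : ∀ k : ℕ, ∀ t, 0 ≤ t → t ≤ 2 ^ k → nuA M t ≤ D * (1 + t) ^ m := by
    have base : ∀ t, 0 ≤ t → t ≤ 1 → nuA M t ≤ D * (1 + t) ^ m := by
      intro t ht ht1
      have h1 := hM.nuA_mono ht ht1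
      have h2 : 1 ≤ (1 + t) ^ m := one_le_pow₀ (by linarith)
      nlinarith
    intro k
    induction k with
    | zero => simpa using base
    | succ k ih =>
      intro t ht htk
      rcases le_total t 1 with h1 | h1
      · exact base t ht h1
      · have h2 := ih (t / 2) (by positivity) (by rw [pow_succ] at htk; linarith)
        have h3 := h (t / 2) (by positivity)
        rw [mul_div_cancel₀ _ (by norm_num)] at h3
        have h4 : 1 ≤ (1 + t / 2) ^ m := one_le_pow₀ (by linarith)
        have h5 : (4 / 3) ^ m * (1 + t / 2) ^ m ≤ (1 + t) ^ m := by
          rw [← mul_pow]; gcongr; linarith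
        calc nuA M t ≤ L * (D * (1 + t / 2) ^ m) + C := by
              refine h3.trans ?_; gcongr
          _ ≤ L * (D * (1 + t / 2) ^ m) + D * (1 + t / 2) ^ m := by
              have : C ≤ D := by simp [D, hn1]
              nlinarith
          _ = D * ((L + 1) * (1 + t / 2) ^ m) := by ring
          _ ≤ D * ((4 / 3) ^ m * (1 + t / 2) ^ m) := by gcongr
          _ ≤ _ := by gcongr
  refine ⟨D, m, hD, fun t ht => ?_⟩
  obtain ⟨k, hk⟩ := pow_unbounded_of_one_lt t (one_lt_two)
  exact key k t ht hk.le

lemma M2star.abs_nuA_sub_le (hM : IsWeightSeq M) (h : M2star M) :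
    ∃ m : ℕ, ∀ ε : ℝ, 0 < ε → ∃ C : ℝ, 0 ≤ C ∧ ∀ s s' τ : ℝ, 0 ≤ s → 0 ≤ s' → |s - s'| ≤ τ →
      |nuA M s' - nuA M s| ≤ (ε * nuA M s + C) * (2 + 2 * τ) ^ m := by
  obtain ⟨D, m, hD, hpow⟩ := h.nuA_le_pow hM
  obtain ⟨L, C₁, hL, hC₁, h2⟩ := h.nuA_two_mul_le hM
  have step : ∀ a b τ, 0 ≤ a → a ≤ b → b - a ≤ τ →
      nuA M b - nuA M a ≤ 2 * τ / max a 1 * (L * nuA M a + C₁) + D * (2 + 2 * τ) ^ m := by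
    intro a b τ ha hab hτ
    have hτ0 : 0 ≤ τ := by linarith
    have na := hM.nuA_nonneg ha
    have hP : 0 ≤ 2 * τ / max a 1 * (L * nuA M a + C₁) := by positivity
    have hbig : b ≤ 1 + 2 * τ → nuA M b ≤ D * (2 + 2 * τ) ^ m := by
      intro hb
      refine (hM.nuA_mono (ha.trans hab) hb).trans ((hpow _ (by linarith)).trans (le_of_eq ?_))
      ring
    rcases le_total a 1 with h1 | h1
    · have := hbig (by linarith)
      linarith
    · rw [max_eq_left h1]
      rw [max_eq_left h1] at hP
      rcases le_total b (2 * a) with h3 | h3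
      · have k := hM.nuA_le_of_le_two_mul (by linarith) hab h3
        have k2 := h2 a ha
        have n2 := hM.nuA_nonneg (t := 2 * a) (by positivity)
        have k3 : 2 * ((b - a) / a) * nuA M (2 * a) ≤ 2 * τ / a * (L * nuA M a + C₁) := by
          rw [mul_div_assoc]
          gcongr
        have : 0 ≤ D * (2 + 2 * τ) ^ m := by positivity
        linarith
      · have := hbig (by linarith)
        linarith
  refine ⟨m + 2, fun ε hε => ?_⟩
  set T := L / ε with hT
  have hT0 : 0 < T := by positivity
  have nT := hM.nuA_nonneg hT0.le
  refine ⟨L * nuA M T + C₁ + D, by positivity, fun s s' τ hs hs' hτ => ?_⟩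
  have hτ0 : 0 ≤ τ := (abs_nonneg _).trans hτ
  have ns := hM.nuA_nonneg hs
  have hlow : 1 / max s 1 * (L * nuA M s + C₁) ≤ ε * nuA M s + (L * nuA M T + C₁) := by
    have h1 : 1 / max s 1 ≤ 1 := by
      rw [div_le_one (by positivity)]; exact le_max_right _ _
    rcases le_total s T with h3 | h3
    · have := hM.nuA_mono hs h3
      calc 1 / max s 1 * (L * nuA M s + C₁) ≤ 1 * (L * nuA M T + C₁) := by gcongr
        _ ≤ _ := by nlinarith
    · have h4 : 1 / max s 1 * L ≤ ε := by
        rw [div_mul_eq_mul_div, one_mul, div_le_iff₀ (by positivity)]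
        have : L = ε * T := by rw [hT]; field_simp
        have := le_max_left s 1
        nlinarith
      calc 1 / max s 1 * (L * nuA M s + C₁)
          = 1 / max s 1 * L * nuA M s + 1 / max s 1 * C₁ := by ring
        _ ≤ ε * nuA M s + 1 * C₁ := by gcongr
        _ ≤ _ := by nlinarith
  have main : |nuA M s' - nuA M s| ≤
      2 * τ * (1 + τ) * (1 / max s 1 * (L * nuA M s + C₁)) + D * (2 + 2 * τ) ^ m := by
    rcases le_total s s' with h3 | h3
    · rw [abs_of_nonneg (sub_nonneg.2 (hM.nuA_mono hs h3))]
      refine (step s s' τ hs h3 (by rw [abs_sub_comm] at hτ; exact (le_abs_self _).trans hτ)).trans ?_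
      gcongr ?_ + _
      rw [div_mul_eq_mul_div, mul_div_assoc, div_mul_eq_mul_div, one_mul]
      have : 0 ≤ (L * nuA M s + C₁) / max s 1 := by positivity
      nlinarith [mul_nonneg (mul_nonneg hτ0 hτ0) this]
    · rw [abs_sub_comm, abs_of_nonneg (sub_nonneg.2 (hM.nuA_mono hs' h3))]
      have hd : s - s' ≤ τ := (le_abs_self _).trans hτ
      refine (step s' s τ hs' h3 hd).trans ?_
      gcongr ?_ + _
      have h5 : max s 1 ≤ max s' 1 * (1 + τ) := by
        have := le_max_left s' 1
        have := le_max_right s' 1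
        apply max_le <;> nlinarith
      have h6 : 2 * τ / max s' 1 ≤ 2 * τ * (1 + τ) * (1 / max s 1) := by
        rw [mul_one_div, div_le_div_iff₀ (by positivity) (by positivity)]
        calc 2 * τ * max s 1 ≤ 2 * τ * (max s' 1 * (1 + τ)) := by gcongr
          _ = _ := by ring
      have := hM.nuA_mono hs' h3
      have := hM.nuA_nonneg hs'
      calc _ ≤ 2 * τ * (1 + τ) * (1 / max s 1) * (L * nuA M s + C₁) := by gcongr
        _ = _ := by ring
  refine main.trans ?_
  have hp1 : (1:ℝ) ≤ (2 + 2 * τ) ^ m := one_le_pow₀ (by linarith)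
  have hp2 : (2 + 2 * τ) ^ m ≤ (2 + 2 * τ) ^ (m + 2) :=
    pow_le_pow_right₀ (by linarith) (by lia)
  have hp3 : 2 * τ * (1 + τ) ≤ (2 + 2 * τ) ^ (m + 2) := by
    rw [pow_add]
    nlinarith
  have hX : 0 ≤ ε * nuA M s + (L * nuA M T + C₁) := by positivity
  calc 2 * τ * (1 + τ) * (1 / max s 1 * (L * nuA M s + C₁)) + D * (2 + 2 * τ) ^ m
      ≤ (2 + 2 * τ) ^ (m + 2) * (ε * nuA M s + (L * nuA M T + C₁)) +
        D * (2 + 2 * τ) ^ (m + 2) := by gcongr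
    _ = _ := by ring

end SlowVariation

section DecayWeights

variable {A : ℕ → ℝ} {d : ℕ}

lemma factSubset.exp_nuA_le (hA : IsWeightSeq A) (h : factSubset A) :
    ∃ C L : ℝ, 1 ≤ C ∧ 1 ≤ L ∧ ∀ t, 0 ≤ t → Real.exp (nuA A t) ≤ C * Real.exp (L * t) := by
  obtain ⟨C, L, hC, hL, h⟩ := h
  refine ⟨C, L, hC, hL, fun t ht => hA.exp_nuA_le ht fun p => ?_⟩
  have h1 := Real.pow_div_factorial_le_exp (L * t) (by positivity) p
  rw [div_le_iff₀ (by positivity), mul_pow] at h1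
  have h2 := h p
  have hLp : 0 < L ^ p := by positivity
  have h3 : L ^ p * t ^ p ≤ L ^ p * (C * Real.exp (L * t) * A p) := by
    calc L ^ p * t ^ p ≤ Real.exp (L * t) * (p.factorial : ℝ) := h1
      _ ≤ Real.exp (L * t) * (C * L ^ p * A p) := by gcongr
      _ = _ := by ring
  exact le_of_mul_le_mul_left h3 hLp

lemma measurable_nuA (A : ℕ → ℝ) : Measurable (nuA A) := by
  unfold nuA
  exact Measurable.iSup fun p => by fun_prop

lemma IsWeightSeq.nuA_norm_le (hA : IsWeightSeq A) {h : ℝ} (hh : 0 ≤ h) (x y : Rd d) :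
    nuA A (h / 2 * ‖x‖) ≤ nuA A (h * ‖y‖) + nuA A (h * ‖x - y‖) := by
  have hx : ‖x‖ ≤ ‖y‖ + ‖x - y‖ := by
    calc ‖x‖ = ‖y + (x - y)‖ := by congr 1; abel
      _ ≤ _ := norm_add_le _ _
  have n1 := hA.nuA_nonneg (t := h * ‖y‖) (by positivity)
  have n2 := hA.nuA_nonneg (t := h * ‖x - y‖) (by positivity)
  rcases le_total ‖y‖ ‖x - y‖ with hc | hc
  · have := hA.nuA_mono (s := h / 2 * ‖x‖) (t := h * ‖x - y‖) (by positivity)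
      (by nlinarith [norm_nonneg x])
    linarith
  · have := hA.nuA_mono (s := h / 2 * ‖x‖) (t := h * ‖y‖) (by positivity)
      (by nlinarith [norm_nonneg x])
    linarith

lemma IsWeightSeq.exp_neg_nuA_mul_le (hA : IsWeightSeq A) {h : ℝ} (hh : 0 ≤ h) (x y : Rd d) :
    Real.exp (-nuA A (h * ‖y‖)) ≤
      Real.exp (nuA A (h * ‖x - y‖)) * Real.exp (-nuA A (h / 2 * ‖x‖)) := by
  rw [← Real.exp_add, Real.exp_le_exp]
  linarith [hA.nuA_norm_le hh x y]

lemma M2.exp_neg_nuA_le (hA : IsWeightSeq A) (h2 : M2 A) {h : ℝ} (hh : 0 < h) (p : ℕ) :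
    ∃ C : ℝ, 0 < C ∧ ∀ x : Rd d,
      Real.exp (-nuA A (h * ‖x‖)) ≤ C * (1 + ‖x‖) ^ (-(p : ℝ)) := by
  obtain ⟨C, hC, h1⟩ := h2.exists_pow_mul_exp_le hA one_pos p
  set r := min h 1 with hr
  have hr0 : 0 < r := lt_min hh one_pos
  refine ⟨C / r ^ p, by positivity, fun x => ?_⟩
  have h3 := h1 (h * ‖x‖) (by positivity)
  have hx : (0:ℝ) < 1 + ‖x‖ := by positivity
  rw [Real.rpow_neg hx.le, Real.rpow_natCast, ← div_eq_mul_inv, le_div_iff₀ (by positivity),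
    le_div_iff₀ (by positivity)]
  have h4 : r * (1 + ‖x‖) ≤ 1 + h * ‖x‖ := by
    have := min_le_left h 1
    have := min_le_right h 1
    nlinarith [norm_nonneg x]
  have h5 : (r * (1 + ‖x‖)) ^ p ≤ (1 + h * ‖x‖) ^ p := by gcongr
  rw [mul_pow] at h5
  rw [one_mul] at h3
  calc _ = r ^ p * (1 + ‖x‖) ^ p * Real.exp (-nuA A (h * ‖x‖)) := by ring
    _ ≤ (1 + h * ‖x‖) ^ p * Real.exp (-nuA A (h * ‖x‖)) := by gcongr
    _ ≤ C := h3

lemma integrable_one_add_norm_rpow (d : ℕ) :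
    Integrable (fun x : Rd d => (1 + ‖x‖) ^ (-((d + 1 : ℕ) : ℝ))) := by
  apply integrable_one_add_norm
  simp

lemma M2.integrable_exp_neg_nuA (hA : IsWeightSeq A) (h2 : M2 A) {h : ℝ} (hh : 0 < h) :
    Integrable (fun x : Rd d => Real.exp (-nuA A (h * ‖x‖))) := by
  obtain ⟨C, hC, h1⟩ := h2.exp_neg_nuA_le (d := d) hA hh (d + 1)
  refine ((integrable_one_add_norm_rpow d).const_mul C).mono' ?_ ?_
  · exact (Real.measurable_exp.comp ((measurable_nuA A).comp
      (measurable_norm.const_mul h)).neg).aestronglyMeasurable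
  · filter_upwards with x
    rw [Real.norm_eq_abs, Real.abs_exp]
    exact h1 x

lemma integrable_exp_neg_norm {r : ℝ} (hr : 0 < r) :
    Integrable (fun x : Rd d => Real.exp (-(r * ‖x‖))) := by
  have hc : ∀ x : Rd d, Real.exp (-(r * ‖x‖)) ≤
      ((d + 1).factorial / (min r 1) ^ (d + 1) * Real.exp 1) * (1 + ‖x‖) ^ (-((d + 1 : ℕ) : ℝ)) := by
    intro x
    have hx : (0:ℝ) < 1 + ‖x‖ := by positivity
    have hr0 : 0 < min r 1 := lt_min hr one_pos
    rw [Real.rpow_neg hx.le, Real.rpow_natCast, ← div_eq_mul_inv, le_div_iff₀ (by positivity),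
      div_mul_eq_mul_div, le_div_iff₀ (by positivity)]
    have h1 := Real.pow_div_factorial_le_exp (min r 1 * (1 + ‖x‖)) (by positivity) (d + 1)
    rw [div_le_iff₀ (by positivity), mul_pow] at h1
    have h2 : Real.exp (-(r * ‖x‖)) * Real.exp (min r 1 * (1 + ‖x‖)) ≤ Real.exp 1 := by
      rw [← Real.exp_add, Real.exp_le_exp]
      have := min_le_left r 1
      have := min_le_right r 1
      nlinarith [norm_nonneg x]
    calc _ = Real.exp (-(r * ‖x‖)) * (min r 1 ^ (d + 1) * (1 + ‖x‖) ^ (d + 1)) := by ring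
      _ ≤ Real.exp (-(r * ‖x‖)) * (Real.exp (min r 1 * (1 + ‖x‖)) * (d + 1).factorial) := by gcongr
      _ = Real.exp (-(r * ‖x‖)) * Real.exp (min r 1 * (1 + ‖x‖)) * (d + 1).factorial := by ring
      _ ≤ Real.exp 1 * (d + 1).factorial := by gcongr
      _ = _ := by ring
  refine ((integrable_one_add_norm_rpow d).const_mul
    ((d + 1).factorial / (min r 1) ^ (d + 1) * Real.exp 1)).mono' (by fun_prop) ?_
  filter_upwards with x
  rw [Real.norm_eq_abs, Real.abs_exp]
  exact hc x

end DecayWeights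

section Derivatives

variable {d : ℕ} {f g : Rd d → ℂ}

lemma contDiff_dop (hf : ContDiff ℝ (⊤ : ℕ∞) f) (j : Fin d) :
    ContDiff ℝ (⊤ : ℕ∞) (dop j f) :=
  (hf.fderiv_right (m := (⊤ : ℕ∞)) (by simp)).clm_apply contDiff_const

lemma contDiff_dop_iterate (hf : ContDiff ℝ (⊤ : ℕ∞) f) (j : Fin d) (n : ℕ) :
    ContDiff ℝ (⊤ : ℕ∞) ((dop j)^[n] f) := by
  induction n with
  | zero => exact hf
  | succ n ih => rw [Function.iterate_succ_apply']; exact contDiff_dop ih j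

lemma dop_comm (hf : ContDiff ℝ (⊤ : ℕ∞) f) (i j : Fin d) :
    dop i (dop j f) = dop j (dop i f) := by
  have hd : Differentiable ℝ (fderiv ℝ f) :=
    (hf.fderiv_right (m := (⊤ : ℕ∞)) (by simp)).differentiable (by simp)
  have key : ∀ (a b : Fin d) (x : Rd d), dop a (dop b f) x =
      fderiv ℝ (fderiv ℝ f) x (EuclideanSpace.single a 1) (EuclideanSpace.single b 1) := by
    intro a b x
    unfold dop
    rw [fderiv_clm_apply (hd x) (by fun_prop)]
    simp
  ext x
  rw [key, key]
  have : IsSymmSndFDerivAt ℝ f x := hf.contDiffAt.isSymmSndFDerivAt (by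
    simp only [minSmoothness_of_isRCLikeNormedField]
    exact WithTop.coe_le_coe.2 (le_top : (2 : ℕ∞) ≤ ⊤))
  exact this _ _

lemma dop_iterate_dop (hf : ContDiff ℝ (⊤ : ℕ∞) f) (i j : Fin d) (n : ℕ) :
    (dop i)^[n] (dop j f) = dop j ((dop i)^[n] f) := by
  induction n with
  | zero => rfl
  | succ n ih =>
    rw [Function.iterate_succ_apply', ih, dop_comm (contDiff_dop_iterate hf i n),
      Function.iterate_succ_apply']

lemma contDiff_foldr_dop (hf : ContDiff ℝ (⊤ : ℕ∞) f) (α : Fin d → ℕ) (l : List (Fin d)) :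
    ContDiff ℝ (⊤ : ℕ∞) (l.foldr (fun j g => (dop j)^[α j] g) f) := by
  induction l with
  | nil => exact hf
  | cons i l ih => exact contDiff_dop_iterate ih i _

lemma contDiff_pD (hf : ContDiff ℝ (⊤ : ℕ∞) f) (α : Fin d → ℕ) : ContDiff ℝ (⊤ : ℕ∞) (pD α f) :=
  contDiff_foldr_dop hf α _

@[simp] lemma pD_zero (f : Rd d → ℂ) : pD 0 f = f := by
  unfold pD
  induction List.finRange d with
  | nil => rfl
  | cons i l ih => simp

@[simp] lemma msize_zero : msize (0 : Fin d → ℕ) = 0 := by simp [msize]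

lemma msize_add (α β : Fin d → ℕ) : msize (α + β) = msize α + msize β := by
  simp [msize, Finset.sum_add_distrib]

@[simp] lemma msize_single (j : Fin d) (n : ℕ) : msize (Pi.single j n : Fin d → ℕ) = n := by
  simp [msize]

lemma pD_add_single (hf : ContDiff ℝ (⊤ : ℕ∞) f) (α : Fin d → ℕ) (j : Fin d) :
    pD (α + Pi.single j 1) f = dop j (pD α f) := by
  have key : ∀ l : List (Fin d), l.Nodup →
      (l.foldr (fun i g => (dop i)^[(α + Pi.single j 1 : Fin d → ℕ) i] g) f) =
        if j ∈ l then dop j (l.foldr (fun i g => (dop i)^[α i] g) f)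
        else l.foldr (fun i g => (dop i)^[α i] g) f := by
    intro l hl
    induction l with
    | nil => simp
    | cons i l ih =>
      rw [List.nodup_cons] at hl
      rw [List.foldr_cons, ih hl.2, List.foldr_cons]
      by_cases hij : j = i
      · subst hij
        simp [hl.1, Function.iterate_succ_apply']
      · have : (α + Pi.single j 1 : Fin d → ℕ) i = α i := by simp [Pi.single_eq_of_ne (Ne.symm hij)]
        rw [this]
        by_cases hjl : j ∈ l
        · rw [if_pos hjl, if_pos (List.mem_cons_of_mem _ hjl),
            dop_iterate_dop (contDiff_foldr_dop hf α l)]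
        · rw [if_neg hjl, if_neg (by simp [hij, hjl])]
  have := key (List.finRange d) (List.nodup_finRange d)
  rwa [if_pos (List.mem_finRange j)] at this

lemma multiindex_induction {P : (Fin d → ℕ) → Prop} (h0 : P 0)
    (hs : ∀ α j, P α → P (α + Pi.single j 1)) (α : Fin d → ℕ) : P α := by
  induction hn : msize α generalizing α with
  | zero =>
    have : α = 0 := by
      ext j
      simpa using (Finset.sum_eq_zero_iff.1 hn) j (Finset.mem_univ j)
    exact this ▸ h0
  | succ n ih =>
    obtain ⟨j, hj⟩ : ∃ j, α j ≠ 0 := by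
      by_contra! hc
      simp [msize, hc] at hn
    have hα : (α - Pi.single j 1) + Pi.single j 1 = α := by
      ext i
      by_cases hij : i = j
      · subst hij; simp; lia
      · simp [Pi.single_eq_of_ne hij]
    have hm := msize_add (α - Pi.single j 1) (Pi.single j 1)
    rw [hα, msize_single, hn] at hm
    exact hα ▸ hs _ j (ih _ (by lia))

lemma pD_pD (hf : ContDiff ℝ (⊤ : ℕ∞) f) (α β : Fin d → ℕ) :
    pD α (pD β f) = pD (α + β) f := by
  induction α using multiindex_induction with
  | h0 => simp
  | hs α j ih =>
    rw [pD_add_single (contDiff_pD hf β), ih, add_right_comm, pD_add_single hf]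

lemma pD_single (hf : ContDiff ℝ (⊤ : ℕ∞) f) (j : Fin d) (n : ℕ) :
    pD (Pi.single j n) f = (dop j)^[n] f := by
  induction n with
  | zero => simp
  | succ n ih =>
    rw [Function.iterate_succ_apply', ← ih, ← pD_add_single hf, ← Pi.single_add]

lemma iteratedDeriv_line (hf : ContDiff ℝ (⊤ : ℕ∞) f) (j : Fin d) (n : ℕ) (x : Rd d) :
    iteratedDeriv n (fun t : ℝ => f (x + t • EuclideanSpace.single j (1:ℝ))) =
      fun t => (dop j)^[n] f (x + t • EuclideanSpace.single j (1:ℝ)) := by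
  induction n with
  | zero => simp
  | succ n ih =>
    rw [iteratedDeriv_succ, ih]
    ext t
    have hd : DifferentiableAt ℝ ((dop j)^[n] f) (x + t • EuclideanSpace.single j (1:ℝ)) :=
      (contDiff_dop_iterate hf j n).differentiable (by simp) _
    have h2 : HasDerivAt (fun t : ℝ => x + t • EuclideanSpace.single j (1:ℝ))
        (EuclideanSpace.single j (1:ℝ)) t := by
      simpa using ((hasDerivAt_id t).smul_const (EuclideanSpace.single j (1:ℝ))).const_add x
    rw [Function.iterate_succ_apply']
    exact (hd.hasFDerivAt.comp_hasDerivAt t h2).deriv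

/-- Leibniz-type bound for pure derivatives of products in the class of a weight sequence. -/
lemma IsWeightSeq.norm_dop_iterate_mul_le {M : ℕ → ℝ} (hM : IsWeightSeq M)
    (hf : ContDiff ℝ (⊤ : ℕ∞) f) (hg : ContDiff ℝ (⊤ : ℕ∞) g) {j : Fin d} {x : Rd d}
    {a b K₁ K₂ : ℝ} (hK₁ : 0 ≤ K₁) (hK₂ : 0 ≤ K₂)
    (h1 : ∀ n, ‖(dop j)^[n] f x‖ ≤ a * K₁ ^ n * M n)
    (h2 : ∀ n, ‖(dop j)^[n] g x‖ ≤ b * K₂ ^ n * M n) (n : ℕ) :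
    ‖(dop j)^[n] (fun y => f y * g y) x‖ ≤ a * b * (K₁ + K₂) ^ n * M n := by
  have hline : ContDiff ℝ (⊤ : ℕ∞) (fun t : ℝ => x + t • EuclideanSpace.single j (1:ℝ)) := by
    fun_prop
  have e1 : ∀ {u : Rd d → ℂ} (_ : ContDiff ℝ (⊤ : ℕ∞) u) (k : ℕ),
      ‖iteratedFDeriv ℝ k (fun t : ℝ => u (x + t • EuclideanSpace.single j (1:ℝ))) 0‖ =
        ‖(dop j)^[k] u x‖ := by
    intro u hu k
    rw [norm_iteratedFDeriv_eq_norm_iteratedDeriv, iteratedDeriv_line hu]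
    simp
  have ha : 0 ≤ a := by
    have := (norm_nonneg _).trans (h1 0)
    simpa [hM.2.1] using this
  have hb : 0 ≤ b := by
    have := (norm_nonneg _).trans (h2 0)
    simpa [hM.2.1] using this
  have := norm_iteratedFDeriv_mul_le (𝕜 := ℝ) (hf.comp hline) (hg.comp hline) (0 : ℝ) (n := n)
    (by exact_mod_cast le_top)
  rw [← e1 (hf.mul hg)]
  refine this.trans ?_
  calc _ ≤ ∑ i ∈ Finset.range (n + 1), (n.choose i : ℝ) * (a * K₁ ^ i * M i) *
        (b * K₂ ^ (n - i) * M (n - i)) := by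
        apply Finset.sum_le_sum
        intro i _
        have p1 := hM.pos i
        gcongr
        · exact (e1 hf i).le.trans (h1 i)
        · exact (e1 hg (n - i)).le.trans (h2 (n - i))
    _ ≤ ∑ i ∈ Finset.range (n + 1), (K₁ ^ i * K₂ ^ (n - i) * (n.choose i : ℝ)) * (a * b * M n) := by
        apply Finset.sum_le_sum
        intro i hi
        rw [Finset.mem_range] at hi
        have h3 := hM.mul_le i (n - i)
        rw [show i + (n - i) = n by lia] at h3
        calc _ = (K₁ ^ i * K₂ ^ (n - i) * (n.choose i : ℝ)) * (a * b * (M i * M (n - i))) := by ring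
          _ ≤ _ := by gcongr
    _ = _ := by rw [← Finset.sum_mul, ← add_pow]; ring

lemma dop_comp_sub_right (f : Rd d → ℂ) (j : Fin d) (s : Rd d) :
    dop j (fun y => f (y - s)) = fun y => dop j f (y - s) := by
  ext y
  unfold dop
  rw [fderiv_comp_sub]

lemma dop_iterate_comp_sub_right (f : Rd d → ℂ) (j : Fin d) (s : Rd d) (n : ℕ) :
    (dop j)^[n] (fun y => f (y - s)) = fun y => (dop j)^[n] f (y - s) := by
  induction n with
  | zero => rfl
  | succ n ih => rw [Function.iterate_succ_apply', ih, dop_comp_sub_right,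
      Function.iterate_succ_apply']

lemma dop_iterate_cexp_inner (c : ℝ) (v s : Rd d) (j : Fin d) (n : ℕ) :
    (dop j)^[n] (fun y => Complex.exp ((c * inner ℝ v (y - s) : ℝ) : ℂ)) =
      fun y => (((c * v j) ^ n : ℝ) : ℂ) * Complex.exp ((c * inner ℝ v (y - s) : ℝ) : ℂ) := by
  induction n with
  | zero => simp
  | succ n ih =>
    rw [Function.iterate_succ_apply', ih]
    ext y
    have h1 : HasFDerivAt (fun y : Rd d => c * inner ℝ v (y - s)) (c • innerSL ℝ v) y := by
      have : HasFDerivAt (fun y : Rd d => inner ℝ v (y - s)) (innerSL ℝ v) y := by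
        exact ((innerSL ℝ v).hasFDerivAt (x := y - s)).comp y ((hasFDerivAt_id y).sub_const s)
      exact this.const_mul c
    have h2 : HasFDerivAt (fun y : Rd d => ((c * inner ℝ v (y - s) : ℝ) : ℂ))
        (Complex.ofRealCLM.comp (c • innerSL ℝ v)) y :=
      Complex.ofRealCLM.hasFDerivAt.comp y h1
    have h3 := (h2.cexp).const_mul (((c * v j) ^ n : ℝ) : ℂ)
    unfold dop
    rw [h3.fderiv]
    simp [EuclideanSpace.inner_single_right]
    ring

end Derivatives

section FourierSide

open scoped FourierTransform

variable {d : ℕ} {f g : Rd d → ℂ}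

/-- `g` is measurable and all its absolute moments are finite. -/
def HasMoments (g : Rd d → ℂ) : Prop :=
  AEStronglyMeasurable g ∧ ∀ n : ℕ, Integrable (fun ξ : Rd d => ‖ξ‖ ^ n * ‖g ξ‖)

lemma HasMoments.integrable (hg : HasMoments g) : Integrable g := by
  have := hg.2 0
  simp only [pow_zero, one_mul] at this
  exact (integrable_norm_iff hg.1).1 this

lemma HasMoments.coord_mul (hg : HasMoments g) (j : Fin d) :
    HasMoments (fun ξ => 2 * Real.pi * Complex.I * (ξ j : ℂ) * g ξ) := by
  have hm : AEStronglyMeasurable (fun ξ : Rd d => 2 * Real.pi * Complex.I * (ξ j : ℂ) * g ξ) := by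
    refine AEStronglyMeasurable.mul ?_ hg.1
    have : Continuous (fun ξ : Rd d => 2 * Real.pi * Complex.I * (ξ j : ℂ)) := by fun_prop
    exact this.aestronglyMeasurable
  refine ⟨hm, fun n => ?_⟩
  refine ((hg.2 (n + 1)).const_mul (2 * Real.pi)).mono' ?_ ?_
  · exact (by fun_prop : Continuous fun ξ : Rd d => ‖ξ‖ ^ n).aestronglyMeasurable.mul hm.norm
  · filter_upwards with ξ
    have h1 : ‖ξ j‖ ≤ ‖ξ‖ := PiLp.norm_apply_le ξ j
    have h2 : ‖(2 * Real.pi * Complex.I * (ξ j : ℂ) * g ξ)‖ = 2 * Real.pi * ‖ξ j‖ * ‖g ξ‖ := by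
      simp [abs_of_pos Real.pi_pos]
    rw [h2, norm_mul, norm_pow, norm_norm, norm_mul, norm_mul, norm_norm, norm_norm, pow_succ]
    rw [Real.norm_of_nonneg (by positivity : (0:ℝ) ≤ 2 * Real.pi)]
    calc ‖ξ‖ ^ n * (2 * Real.pi * ‖ξ j‖ * ‖g ξ‖) ≤ ‖ξ‖ ^ n * (2 * Real.pi * ‖ξ‖ * ‖g ξ‖) := by gcongr
      _ = _ := by ring

lemma M2.hasMoments {M : ℕ → ℝ} (hM : IsWeightSeq M) (h2 : M2 M) {l C : ℝ} (hl : 0 < l)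
    (hm : AEStronglyMeasurable g)
    (hb : ∀ ξ, ‖g ξ‖ ≤ C * Real.exp (-(l * nuA M ‖ξ‖))) : HasMoments g := by
  refine ⟨hm, fun n => ?_⟩
  obtain ⟨D, hD, h1⟩ := h2.exists_pow_mul_exp_le hM hl (n + (d + 1))
  refine ((integrable_one_add_norm_rpow d).const_mul (C * D)).mono'
    ((by fun_prop : Continuous fun ξ : Rd d => ‖ξ‖ ^ n).aestronglyMeasurable.mul hm.norm) ?_
  filter_upwards with ξ
  have hx : (0:ℝ) < 1 + ‖ξ‖ := by positivity
  have hC : 0 ≤ C := by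
    have := (norm_nonneg _).trans (hb 0)
    exact nonneg_of_mul_nonneg_left this (Real.exp_pos _)
  have h3 := h1 ‖ξ‖ (norm_nonneg _)
  rw [Real.rpow_neg hx.le, Real.rpow_natCast, ← div_eq_mul_inv, le_div_iff₀ (by positivity),
    norm_mul, norm_pow, norm_norm, norm_norm]
  have h4 : ‖ξ‖ ^ n ≤ (1 + ‖ξ‖) ^ n := by gcongr; linarith
  calc ‖ξ‖ ^ n * ‖g ξ‖ * (1 + ‖ξ‖) ^ (d + 1)
      ≤ (1 + ‖ξ‖) ^ n * (C * Real.exp (-(l * nuA M ‖ξ‖))) * (1 + ‖ξ‖) ^ (d + 1) := by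
        gcongr; exact hb ξ
    _ = C * ((1 + ‖ξ‖) ^ (n + (d + 1)) * Real.exp (-(l * nuA M ‖ξ‖))) := by ring
    _ ≤ C * D := by gcongr

lemma norm_fourier_le (f : Rd d → ℂ) (ξ : Rd d) : ‖𝓕 f ξ‖ ≤ ∫ x, ‖f x‖ := by
  rw [Real.fourier_eq]
  refine (norm_integral_le_integral_norm _).trans (le_of_eq ?_)
  simp

lemma MeasureTheory.Integrable.continuous_fourier (hf : Integrable f) : Continuous (𝓕 f) :=
  VectorFourier.fourierIntegral_continuous Real.continuous_fourierChar
    (by exact continuous_inner) hf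

lemma HasMoments.contDiff_fourierInv (hg : HasMoments g) : ContDiff ℝ (⊤ : ℕ∞) (𝓕⁻ g) := by
  have h1 : ContDiff ℝ (⊤ : ℕ∞) (𝓕 g) := Real.contDiff_fourier fun n _ => hg.2 n
  have h2 : 𝓕⁻ g = fun x => 𝓕 g (-x) := by
    ext x; exact Real.fourierInv_eq_fourier_neg g x
  rw [h2]
  exact h1.comp contDiff_neg

lemma HasMoments.dop_fourierInv (hg : HasMoments g) (j : Fin d) :
    dop j (𝓕⁻ g) = 𝓕⁻ (fun ξ => 2 * Real.pi * Complex.I * (ξ j : ℂ) * g ξ) := by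
  have hm1 : Integrable (fun ξ : Rd d => ‖ξ‖ * ‖g ξ‖) := by simpa using hg.2 1
  have h2 : 𝓕⁻ g = fun x => 𝓕 g (-x) := by
    ext x; exact Real.fourierInv_eq_fourier_neg g x
  ext x
  have hd : HasFDerivAt (𝓕 g) (𝓕 (VectorFourier.fourierSMulRight (innerSL ℝ) g) (-x)) (-x) :=
    Real.hasFDerivAt_fourier hg.integrable hm1 (-x)
  have hd2 := hd.comp x (hasFDerivAt_id x).neg
  unfold dop
  rw [h2]
  have := hd2.fderiv
  simp only [Function.comp_def] at this
  rw [this, Real.fourierInv_eq_fourier_neg]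
  simp only [ContinuousLinearMap.comp_neg, ContinuousLinearMap.comp_id, neg_apply]
  rw [Real.fourier_eq, Real.fourier_eq, ContinuousLinearMap.integral_apply, ← integral_neg]
  · congr 1
    ext v
    have : innerSL ℝ v (EuclideanSpace.single j (1:ℝ)) = v j := by
      simp [innerSL_apply_apply, EuclideanSpace.inner_single_right]
    simp [Circle.smul_def, this, mul_assoc]
  · have : Integrable (VectorFourier.fourierSMulRight (innerSL ℝ) g) :=
      (hm1.const_mul (2 * Real.pi * ‖innerSL ℝ (E := Rd d)‖)).mono'
        hg.1.fourierSMulRight (Eventually.of_forall fun v =>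
          (VectorFourier.norm_fourierSMulRight_le (innerSL ℝ) g v).trans (le_of_eq (by ring)))
    exact (Real.fourierIntegral_convergent_iff (-x)).2 this

lemma fourier_dop (hf : ContDiff ℝ (⊤ : ℕ∞) f) (j : Fin d) (h0 : Integrable f)
    (h1 : Integrable (dop j f)) (ξ : Rd d) :
    𝓕 (dop j f) ξ = 2 * Real.pi * Complex.I * (ξ j : ℂ) * 𝓕 f ξ := by
  set e : Rd d → ℂ := fun y => Complex.exp ((↑(-2 * Real.pi * inner ℝ y ξ) * Complex.I)) with he
  have hee : ∀ y, HasFDerivAt e (e y •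
      ((Complex.I • (Complex.ofRealCLM.comp ((-2 * Real.pi) • innerSL ℝ ξ))) : Rd d →L[ℝ] ℂ)) y := by
    intro y
    have h1 : HasFDerivAt (fun y : Rd d => -2 * Real.pi * inner ℝ y ξ)
        ((-2 * Real.pi) • innerSL ℝ ξ) y := by
      have : (fun y : Rd d => -2 * Real.pi * inner ℝ y ξ) =
          fun y => ((-2 * Real.pi) • innerSL ℝ ξ) y := by
        ext y; simp [real_inner_comm]
      rw [this]
      exact ContinuousLinearMap.hasFDerivAt _
    have h2 := (Complex.ofRealCLM.hasFDerivAt.comp y h1).mul_const Complex.I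
    exact h2.cexp
  have hde : ∀ y, fderiv ℝ e y (EuclideanSpace.single j 1) =
      -(2 * Real.pi * Complex.I * (ξ j : ℂ)) * e y := by
    intro y
    rw [(hee y).fderiv]
    simp [EuclideanSpace.inner_single_right]
    ring
  have hne : ∀ y, ‖e y‖ = 1 := fun y => by
    rw [he]; exact Complex.norm_exp_ofReal_mul_I _
  have hce : Continuous e := by
    rw [he]; fun_prop
  have h_int : ∀ {u : Rd d → ℂ}, Integrable u → Integrable (fun y => e y * u y) := by
    intro u hu
    refine hu.norm.mono' (hce.aestronglyMeasurable.mul hu.1) ?_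
    filter_upwards with y
    simp [hne]
  have := integral_mul_fderiv_eq_neg_fderiv_mul_of_integrable (μ := volume) (f := e) (g := f)
    (v := EuclideanSpace.single j (1:ℝ))
    (by simp_rw [hde, mul_assoc (-(2 * Real.pi * Complex.I * (ξ j : ℂ)))]
        exact (h_int h0).const_mul _)
    (h_int h1) (h_int h0) (fun y _ => (hee y).differentiableAt)
    (fun y _ => hf.differentiable (by simp) y)
  rw [Real.fourier_eq', Real.fourier_eq']
  simp only [smul_eq_mul]
  refine this.trans ?_
  simp_rw [hde, mul_assoc (-(2 * Real.pi * Complex.I * (ξ j : ℂ)))]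
  rw [integral_const_mul]
  ring

lemma fourier_dop_iterate (hf : ContDiff ℝ (⊤ : ℕ∞) f) (j : Fin d)
    (hi : ∀ n, Integrable ((dop j)^[n] f)) (n : ℕ) (ξ : Rd d) :
    𝓕 ((dop j)^[n] f) ξ = (2 * Real.pi * Complex.I * (ξ j : ℂ)) ^ n * 𝓕 f ξ := by
  induction n with
  | zero => simp
  | succ n ih =>
    have h1 := hi (n + 1)
    rw [Function.iterate_succ_apply'] at h1 ⊢
    rw [fourier_dop (contDiff_dop_iterate hf j n) j (hi n) h1, ih]
    ring

/-- Pure derivative bounds in the class of `M` give decay of the Fourier transform governed by the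
associated function of `M`. -/
lemma IsWeightSeq.norm_fourier_le {M : ℕ → ℝ} (hM : IsWeightSeq M)
    (hf : ContDiff ℝ (⊤ : ℕ∞) f) {K : ℝ} (hK : 0 < K) {q : Rd d → ℝ} (hq : Integrable q)
    (h0 : ∀ x, ‖f x‖ ≤ q x)
    (hb : ∀ j n x, ‖(dop j)^[n] f x‖ ≤ K ^ n * M n * q x) (ξ : Rd d) :
    ‖𝓕 f ξ‖ ≤ (∫ x, q x) * Real.exp (-nuA M (‖ξ‖ / (K * (d + 1)))) := by
  have hi : ∀ j n, Integrable ((dop j)^[n] f) := fun j n =>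
    (hq.const_mul (K ^ n * M n)).mono'
      (contDiff_dop_iterate hf j n).continuous.aestronglyMeasurable
      (Eventually.of_forall (hb j n))
  have h00 : ‖𝓕 f ξ‖ ≤ ∫ x, q x := by
    refine (_root_.norm_fourier_le f ξ).trans ?_
    refine integral_mono_of_nonneg (Eventually.of_forall fun _ => norm_nonneg _) hq
      (Eventually.of_forall h0)
  have key : ∀ n, (‖ξ‖ / (K * (d + 1))) ^ n * ‖𝓕 f ξ‖ ≤ (∫ x, q x) * M n := by
    intro n
    have hn0 : 0 ≤ ‖𝓕 f ξ‖ := norm_nonneg _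
    by_cases hξ : ξ = 0
    · rcases n.eq_zero_or_pos with rfl | hn
      · simpa [hM.2.1] using h00
      · have := hM.pos n
        simp only [hξ, norm_zero, zero_div, zero_pow hn.ne', zero_mul]
        exact mul_nonneg (hn0.trans h00) this.le
    · obtain ⟨j, hj⟩ : ∃ j, ‖ξ‖ ≤ (d + 1) * |ξ j| := by
        by_contra! hc
        have h1 : ‖ξ‖ ^ 2 = ∑ i, (ξ i) ^ 2 := by
          rw [EuclideanSpace.norm_sq_eq]; simp
        have hp : 0 < ‖ξ‖ := norm_pos_iff.2 hξ
        have h2 : ((d : ℝ) + 1) ^ 2 * ‖ξ‖ ^ 2 ≤ d * ‖ξ‖ ^ 2 := by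
          calc ((d : ℝ) + 1) ^ 2 * ‖ξ‖ ^ 2 = ∑ i, (((d : ℝ) + 1) * |ξ i|) ^ 2 := by
                rw [h1, Finset.mul_sum]; simp [mul_pow]
            _ ≤ ∑ _i : Fin d, ‖ξ‖ ^ 2 := by
                apply Finset.sum_le_sum; intro i _
                have := (hc i).le
                gcongr
            _ = _ := by simp
        have : (0:ℝ) ≤ d := by positivity
        nlinarith [pow_pos hp 2, mul_nonneg (mul_nonneg this this) (pow_pos hp 2).le,
          mul_nonneg this (pow_pos hp 2).le]
      have h1 := fourier_dop_iterate hf j (hi j) n ξ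
      have h2 : ‖𝓕 ((dop j)^[n] f) ξ‖ ≤ K ^ n * M n * ∫ x, q x := by
        refine (_root_.norm_fourier_le _ ξ).trans ?_
        rw [← integral_const_mul]
        exact integral_mono (hi j n).norm (hq.const_mul _) (hb j n)
      have h3 : ‖(2 * Real.pi * Complex.I * (ξ j : ℂ))‖ = 2 * Real.pi * |ξ j| := by
        simp [abs_of_pos Real.pi_pos]
      rw [h1, norm_mul, norm_pow, h3] at h2
      have h4 : ‖ξ‖ / (d + 1) ≤ 2 * Real.pi * |ξ j| := by
        rw [div_le_iff₀ (by positivity)]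
        have : (0:ℝ) ≤ (d + 1) * |ξ j| := by positivity
        nlinarith [Real.pi_gt_three]
      have h5 : (‖ξ‖ / (K * (d + 1))) ^ n = (‖ξ‖ / (d + 1)) ^ n / K ^ n := by
        rw [← div_pow, div_div, mul_comm K]
      rw [h5, div_mul_eq_mul_div, div_le_iff₀ (by positivity)]
      calc (‖ξ‖ / (d + 1)) ^ n * ‖𝓕 f ξ‖ ≤ (2 * Real.pi * |ξ j|) ^ n * ‖𝓕 f ξ‖ := by gcongr
        _ ≤ _ := h2
        _ = _ := by ring
  rcases (norm_nonneg (𝓕 f ξ)).eq_or_lt with hz | hz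
  · rw [← hz] at h00 ⊢
    positivity
  · have := hM.exp_nuA_le (t := ‖ξ‖ / (K * (d + 1))) (B := (∫ x, q x) / ‖𝓕 f ξ‖) (by positivity)
      fun n => by
        rw [div_mul_eq_mul_div, le_div_iff₀ hz]; exact key n
    rw [le_div_iff₀ hz] at this
    rw [Real.exp_neg, ← div_eq_mul_inv, le_div_iff₀ (Real.exp_pos _), mul_comm]
    exact this

lemma convF_fourierInv {ψ : Rd d → ℂ} (hψ : Integrable ψ) (hg : Integrable g) :
    convF ψ (𝓕⁻ g) = 𝓕⁻ (fun ξ => 𝓕 ψ ξ * g ξ) := by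
  ext x
  unfold convF
  rw [Real.fourierInv_eq']
  simp_rw [Real.fourierInv_eq', Real.fourier_eq', smul_eq_mul, ← integral_const_mul]
  rw [integral_integral_swap]
  · congr 1
    ext ξ
    rw [← integral_mul_const, ← integral_const_mul]
    congr 1
    ext t
    have : Complex.exp (↑(2 * Real.pi * inner ℝ ξ (x - t)) * Complex.I) =
        Complex.exp (↑(2 * Real.pi * inner ℝ ξ x) * Complex.I) *
          Complex.exp (↑(-2 * Real.pi * inner ℝ t ξ) * Complex.I) := by
      rw [← Complex.exp_add, inner_sub_right, real_inner_comm t ξ]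
      congr 1
      push_cast
      ring
    rw [this]
    ring
  · have h := hψ.mul_prod hg
    refine h.norm.mono' ?_ ?_
    · have hc : Continuous (fun p : Rd d × Rd d =>
          Complex.exp (↑(2 * Real.pi * inner ℝ p.2 (x - p.1)) * Complex.I)) := by fun_prop
      have := hc.aestronglyMeasurable (μ := (volume : Measure (Rd d)).prod volume) |>.mul h.1
      refine this.congr (Eventually.of_forall fun p => ?_)
      simp only [Pi.mul_apply, Function.uncurry]
      ring
    · filter_upwards with p
      simp only [Function.uncurry, norm_mul, Complex.norm_exp_ofReal_mul_I, one_mul]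
      exact le_rfl

end FourierSide

section ContourShift

variable {d : ℕ}

/-- `g` is the extension of `ξ ↦ g ξ 0` to the complex lines `ξ + ζ v`: it is entire in `ζ`,
continuous in `ξ` and compatible with real translations along `v`. -/
structure EntireAlong (v : Rd d) (g : Rd d → ℂ → ℂ) : Prop where
  shift : ∀ (ξ : Rd d) (τ : ℝ) (ζ : ℂ), g (ξ + τ • v) ζ = g ξ (ζ + τ)
  entire : ∀ ξ, Differentiable ℂ (g ξ)
  cont : ∀ ζ, Continuous fun ξ => g ξ ζ

namespace EntireAlong

variable {v : Rd d} {g g₁ g₂ : Rd d → ℂ → ℂ}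

lemma const (c : ℂ) : EntireAlong v fun _ _ => c :=
  ⟨fun _ _ _ => rfl, fun _ => by fun_prop, fun _ => by fun_prop⟩

lemma comp {u : ℂ → ℂ} (hu : Differentiable ℂ u) (hg : EntireAlong v g) :
    EntireAlong v fun ξ ζ => u (g ξ ζ) :=
  ⟨fun ξ τ ζ => by rw [hg.shift], fun ξ => hu.comp (hg.entire ξ),
    fun ζ => hu.continuous.comp (hg.cont ζ)⟩

lemma mul (h1 : EntireAlong v g₁) (h2 : EntireAlong v g₂) :
    EntireAlong v fun ξ ζ => g₁ ξ ζ * g₂ ξ ζ :=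
  ⟨fun ξ τ ζ => by rw [h1.shift, h2.shift], fun ξ => (h1.entire ξ).mul (h2.entire ξ),
    fun ζ => (h1.cont ζ).mul (h2.cont ζ)⟩

lemma const_mul (c : ℂ) (h : EntireAlong v g) : EntireAlong v fun ξ ζ => c * g ξ ζ :=
  (const c).mul h

lemma pow (h : EntireAlong v g) (n : ℕ) : EntireAlong v fun ξ ζ => g ξ ζ ^ n :=
  comp (u := fun z => z ^ n) (by fun_prop) h

lemma cexp (h : EntireAlong v g) : EntireAlong v fun ξ ζ => Complex.exp (g ξ ζ) :=
  comp Complex.differentiable_exp h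

lemma prod {ι : Type*} (s : Finset ι) {G : ι → Rd d → ℂ → ℂ} (h : ∀ i, EntireAlong v (G i)) :
    EntireAlong v fun ξ ζ => ∏ i ∈ s, G i ξ ζ := by
  classical
  induction s using Finset.induction_on with
  | empty => simpa using const 1
  | insert i s hi ih => simpa [Finset.prod_insert hi] using (h i).mul ih

lemma inner_right (x : Rd d) :
    EntireAlong v fun ξ ζ => ((inner ℝ ξ x : ℝ) : ℂ) + ζ * ((inner ℝ v x : ℝ) : ℂ) := by
  refine ⟨fun ξ τ ζ => ?_, fun ξ => by fun_prop, fun ζ => by fun_prop⟩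
  rw [inner_add_left, inner_smul_left]
  push_cast
  simp
  ring

lemma coord (j : Fin d) : EntireAlong v fun ξ ζ => ((ξ j : ℝ) : ℂ) + ζ * ((v j : ℝ) : ℂ) := by
  have := inner_right (v := v) (EuclideanSpace.single j (1:ℝ))
  simpa [EuclideanSpace.inner_single_right] using this

lemma normSq : EntireAlong v fun ξ ζ => ((‖ξ‖ ^ 2 : ℝ) : ℂ) + 2 * ζ * ((inner ℝ ξ v : ℝ) : ℂ) +
    ζ ^ 2 * ((‖v‖ ^ 2 : ℝ) : ℂ) := by
  refine ⟨fun ξ τ ζ => ?_, fun ξ => by fun_prop, fun ζ => by fun_prop⟩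
  rw [norm_add_sq_real, inner_add_left, inner_smul_left, inner_smul_right, norm_smul,
    real_inner_self_eq_norm_sq, mul_pow, Real.norm_eq_abs, sq_abs]
  push_cast
  simp
  ring

/-- The Laplace-type transform of a function with all exponential moments. -/
lemma laplace {ρ : Rd d → ℂ} (hm : AEStronglyMeasurable ρ)
    (hi : ∀ r : ℝ, Integrable fun t => Real.exp (r * ‖t‖) * ‖ρ t‖) (a : ℂ) :
    EntireAlong v fun ξ ζ => ∫ t, ρ t *
      Complex.exp (a * (((inner ℝ ξ t : ℝ) : ℂ) + ζ * ((inner ℝ v t : ℝ) : ℂ))) := by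
  have hexp : ∀ (ξ t : Rd d) (ζ : ℂ),
      ‖Complex.exp (a * (((inner ℝ ξ t : ℝ) : ℂ) + ζ * ((inner ℝ v t : ℝ) : ℂ)))‖ ≤
        Real.exp (‖a‖ * (‖ξ‖ + ‖ζ‖ * ‖v‖) * ‖t‖) := by
    intro ξ t ζ
    refine (Complex.norm_exp_le_exp_norm _).trans (Real.exp_le_exp.2 ?_)
    rw [norm_mul, mul_assoc]
    gcongr
    calc _ ≤ ‖((inner ℝ ξ t : ℝ) : ℂ)‖ + ‖ζ * ((inner ℝ v t : ℝ) : ℂ)‖ := norm_add_le _ _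
      _ ≤ ‖ξ‖ * ‖t‖ + ‖ζ‖ * (‖v‖ * ‖t‖) := by
        rw [norm_mul, Complex.norm_real, Complex.norm_real]
        gcongr <;> exact norm_inner_le_norm _ _
      _ = _ := by ring
  have hmeas : ∀ ξ ζ, AEStronglyMeasurable (fun t => ρ t *
      Complex.exp (a * (((inner ℝ ξ t : ℝ) : ℂ) + ζ * ((inner ℝ v t : ℝ) : ℂ)))) := fun ξ ζ =>
    hm.mul (by fun_prop : Continuous fun t : Rd d =>
      Complex.exp (a * (((inner ℝ ξ t : ℝ) : ℂ) + ζ * ((inner ℝ v t : ℝ) : ℂ)))).aestronglyMeasurable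
  have h_int : ∀ ξ ζ, Integrable (fun t => ρ t *
      Complex.exp (a * (((inner ℝ ξ t : ℝ) : ℂ) + ζ * ((inner ℝ v t : ℝ) : ℂ)))) := fun ξ ζ =>
    (hi _).mono' (hmeas ξ ζ) (Eventually.of_forall fun t => by
      rw [norm_mul, mul_comm]
      exact mul_le_mul_of_nonneg_right (hexp ξ t ζ) (norm_nonneg _))
  refine ⟨fun ξ τ ζ => ?_, fun ξ ζ₀ => ?_, fun ζ => ?_⟩
  · congr 1
    ext t
    rw [inner_add_left, inner_smul_left]
    congr 3
    push_cast
    rw [conj_trivial]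
    ring
  · have := hasDerivAt_integral_of_dominated_loc_of_deriv_le (μ := (volume : Measure (Rd d)))
      (F := fun ζ t => ρ t *
        Complex.exp (a * (((inner ℝ ξ t : ℝ) : ℂ) + ζ * ((inner ℝ v t : ℝ) : ℂ))))
      (F' := fun ζ t => ρ t *
        (Complex.exp (a * (((inner ℝ ξ t : ℝ) : ℂ) + ζ * ((inner ℝ v t : ℝ) : ℂ))) *
          (a * ((inner ℝ v t : ℝ) : ℂ))))
      (bound := fun t => ‖a‖ * ‖v‖ *
        (Real.exp ((‖a‖ * (‖ξ‖ + (‖ζ₀‖ + 1) * ‖v‖) + 1) * ‖t‖) * ‖ρ t‖))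
      (x₀ := ζ₀) (Metric.ball_mem_nhds ζ₀ one_pos)
      (Eventually.of_forall fun ζ => hmeas ξ ζ) (h_int ξ ζ₀)
      (hm.mul (by fun_prop : Continuous fun t : Rd d =>
        Complex.exp (a * (((inner ℝ ξ t : ℝ) : ℂ) + ζ₀ * ((inner ℝ v t : ℝ) : ℂ))) *
          (a * ((inner ℝ v t : ℝ) : ℂ))).aestronglyMeasurable)
      (Eventually.of_forall fun t ζ hζ => by
        have h1 : ‖ζ‖ ≤ ‖ζ₀‖ + 1 := by
          rw [mem_ball_iff_norm] at hζ
          calc ‖ζ‖ = ‖ζ₀ + (ζ - ζ₀)‖ := by congr 1; ring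
            _ ≤ _ := (norm_add_le _ _).trans (by gcongr)
        have h2 : ‖t‖ ≤ Real.exp ‖t‖ := by linarith [Real.add_one_le_exp ‖t‖]
        have h3 : ‖((inner ℝ v t : ℝ) : ℂ)‖ ≤ ‖v‖ * Real.exp ‖t‖ := by
          rw [Complex.norm_real]
          exact (norm_inner_le_norm _ _).trans (by gcongr)
        have h4 := hexp ξ t ζ
        rw [norm_mul, norm_mul, norm_mul]
        calc _ ≤ ‖ρ t‖ * (Real.exp (‖a‖ * (‖ξ‖ + (‖ζ₀‖ + 1) * ‖v‖) * ‖t‖) *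
              (‖a‖ * (‖v‖ * Real.exp ‖t‖))) := by
              gcongr
              refine h4.trans (Real.exp_le_exp.2 ?_)
              gcongr
          _ = ‖a‖ * ‖v‖ * ((Real.exp (‖a‖ * (‖ξ‖ + (‖ζ₀‖ + 1) * ‖v‖) * ‖t‖) *
              Real.exp ‖t‖) * ‖ρ t‖) := by ring
          _ = _ := by rw [← Real.exp_add]; congr 4; ring)
      ((hi _).const_mul _)
      (Eventually.of_forall fun t ζ _ => by
        have h1 : HasDerivAt (fun ζ : ℂ =>
            a * (((inner ℝ ξ t : ℝ) : ℂ) + ζ * ((inner ℝ v t : ℝ) : ℂ)))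
            (a * ((inner ℝ v t : ℝ) : ℂ)) ζ := by
          simpa using (((hasDerivAt_id ζ).mul_const ((inner ℝ v t : ℝ) : ℂ)).const_add
            ((inner ℝ ξ t : ℝ) : ℂ)).const_mul a
        exact h1.cexp.const_mul (ρ t))
    exact this.2.differentiableAt
  · rw [continuous_iff_continuousAt]
    intro ξ₀
    refine continuousAt_of_dominated
      (bound := fun t => Real.exp (‖a‖ * ((‖ξ₀‖ + 1) + ‖ζ‖ * ‖v‖) * ‖t‖) * ‖ρ t‖)
      (Eventually.of_forall fun ξ => hmeas ξ ζ) ?_ (hi _)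
      (Eventually.of_forall fun t => by fun_prop)
    filter_upwards [Metric.ball_mem_nhds ξ₀ one_pos] with ξ hξ
    refine Eventually.of_forall fun t => ?_
    have h1 : ‖ξ‖ ≤ ‖ξ₀‖ + 1 := by
      rw [mem_ball_iff_norm] at hξ
      calc ‖ξ‖ = ‖ξ₀ + (ξ - ξ₀)‖ := by congr 1; abel
        _ ≤ _ := (norm_add_le _ _).trans (by gcongr)
    rw [norm_mul, mul_comm]
    gcongr
    refine (hexp ξ t ζ).trans (Real.exp_le_exp.2 ?_)
    gcongr

/-- Shifting the domain of integration by `i η v`. -/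
lemma integral_shift (hg : EntireAlong v g) (hv : ‖v‖ ≤ 1) {R C : ℝ}
    (hb : ∀ (η : ℝ) ξ, |η| ≤ R →
      ‖g ξ (Complex.I * η)‖ ≤ C * (1 + ‖ξ‖) ^ (-((d + 1 : ℕ) : ℝ)))
    {η : ℝ} (hη : |η| < R) :
    ∫ ξ, g ξ 0 = ∫ ξ, g ξ (Complex.I * η) := by
  have hR : 0 < R := (abs_nonneg _).trans_lt hη
  have hC : 0 ≤ C := by
    have := (norm_nonneg _).trans (hb 0 0 (by simpa using hR.le))
    simpa using this
  set p : ℝ := -((d + 1 : ℕ) : ℝ) with hp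
  have hp0 : p ≤ 0 := by rw [hp]; exact neg_nonpos.2 (Nat.cast_nonneg _)
  have hbd : ∀ (T : ℝ) (ζ : ℂ) ξ, |ζ.im| ≤ R → |ζ.re| ≤ T →
      ‖g ξ ζ‖ ≤ C * (1 + T) ^ (-p) * (1 + ‖ξ‖) ^ p := by
    intro T ζ ξ him hre
    have hT : 0 ≤ T := (abs_nonneg _).trans hre
    have h1 : g ξ ζ = g (ξ + ζ.re • v) (Complex.I * ζ.im) := by
      rw [hg.shift]
      congr 1
      rw [mul_comm, add_comm]
      exact (Complex.re_add_im ζ).symm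
    rw [h1]
    refine (hb _ _ him).trans ?_
    rw [mul_assoc]
    gcongr
    have h2 : 1 + ‖ξ‖ ≤ (1 + T) * (1 + ‖ξ + ζ.re • v‖) := by
      have h3 : ‖ξ‖ ≤ ‖ξ + ζ.re • v‖ + T := by
        calc ‖ξ‖ = ‖(ξ + ζ.re • v) - ζ.re • v‖ := by congr 1; abel
          _ ≤ ‖ξ + ζ.re • v‖ + ‖ζ.re • v‖ := norm_sub_le _ _
          _ ≤ _ := by
            rw [norm_smul, Real.norm_eq_abs]
            gcongr
            nlinarith [norm_nonneg v, abs_nonneg ζ.re]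
      nlinarith [norm_nonneg (ξ + ζ.re • v)]
    have h4 := Real.rpow_le_rpow_of_nonpos (by positivity) h2 hp0
    rw [Real.mul_rpow (by positivity) (by positivity)] at h4
    calc (1 + ‖ξ + ζ.re • v‖) ^ p
        = (1 + T) ^ (-p) * ((1 + T) ^ p * (1 + ‖ξ + ζ.re • v‖) ^ p) := by
          rw [← mul_assoc, ← Real.rpow_add (by positivity)]; simp
      _ ≤ _ := by gcongr
  have hmeas : ∀ ζ, AEStronglyMeasurable (fun ξ => g ξ ζ) := fun ζ =>
    (hg.cont ζ).aestronglyMeasurable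
  have h_int : ∀ ζ : ℂ, |ζ.im| ≤ R → Integrable (fun ξ => g ξ ζ) := fun ζ hζ =>
    ((integrable_one_add_norm_rpow d).const_mul _).mono' (hmeas ζ)
      (Eventually.of_forall fun ξ => hbd |ζ.re| ζ ξ hζ le_rfl)
  set S : Set ℂ := {ζ | |ζ.im| < R} with hS
  have hSo : IsOpen S := isOpen_lt (by fun_prop) (by fun_prop)
  have hSc : Convex ℝ S := by
    have : S = Complex.imLm ⁻¹' Metric.ball 0 R := by
      ext ζ; simp [hS]
    rw [this]
    exact (convex_ball _ _).linear_preimage _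
  set Φ : ℂ → ℂ := fun ζ => ∫ ξ, g ξ ζ with hΦ
  have hD : DifferentiableOn ℂ Φ S := by
    intro ζ₀ hζ₀
    refine DifferentiableAt.differentiableWithinAt ?_
    set r := (R - |ζ₀.im|) / 2 with hr
    have hζ₀' : |ζ₀.im| < R := hζ₀
    have hr0 : 0 < r := by rw [hr]; linarith
    have hball : ∀ ζ ∈ Metric.ball ζ₀ r, ∀ z ∈ Metric.sphere ζ r,
        |z.im| ≤ R ∧ |z.re| ≤ |ζ₀.re| + 2 * r := by
      intro ζ hζ z hz
      have h1 : ‖z - ζ₀‖ ≤ 2 * r := by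
        rw [mem_ball_iff_norm] at hζ
        rw [mem_sphere_iff_norm] at hz
        calc ‖z - ζ₀‖ = ‖(z - ζ) + (ζ - ζ₀)‖ := by congr 1; ring
          _ ≤ _ := (norm_add_le _ _).trans (by linarith)
      have h2 := (Complex.abs_im_le_norm (z - ζ₀)).trans h1
      have h3 := (Complex.abs_re_le_norm (z - ζ₀)).trans h1
      rw [Complex.sub_im] at h2
      rw [Complex.sub_re] at h3
      constructor
      · have := abs_sub_abs_le_abs_sub z.im ζ₀.im
        linarith
      · have := abs_sub_abs_le_abs_sub z.re ζ₀.re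
        linarith
    have := hasDerivAt_integral_of_dominated_loc_of_deriv_le (μ := (volume : Measure (Rd d)))
      (F := fun ζ ξ => g ξ ζ) (F' := fun ζ ξ => deriv (g ξ) ζ)
      (bound := fun ξ => (C * (1 + (|ζ₀.re| + 2 * r)) ^ (-p) / r) * (1 + ‖ξ‖) ^ p)
      (x₀ := ζ₀) (Metric.ball_mem_nhds ζ₀ hr0)
      (Eventually.of_forall hmeas) (h_int ζ₀ hζ₀'.le)
      (by
        refine aestronglyMeasurable_of_tendsto_ae (nhdsWithin (0:ℂ) {0}ᶜ)
          (f := fun t ξ => t⁻¹ • (g ξ (ζ₀ + t) - g ξ ζ₀))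
          (fun t => (((hg.cont (ζ₀ + t)).sub (hg.cont ζ₀)).const_smul t⁻¹).aestronglyMeasurable)
          (Eventually.of_forall fun ξ => ?_)
        exact hasDerivAt_iff_tendsto_slope_zero.1 (hg.entire ξ ζ₀).hasDerivAt)
      (Eventually.of_forall fun ξ ζ hζ => by
        have := Complex.norm_deriv_le_of_forall_mem_sphere_norm_le hr0
          (hg.entire ξ).diffContOnCl (C := C * (1 + (|ζ₀.re| + 2 * r)) ^ (-p) * (1 + ‖ξ‖) ^ p)
          (c := ζ)
          fun z hz => hbd _ z ξ (hball ζ hζ z hz).1 (hball ζ hζ z hz).2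
        refine this.trans (le_of_eq ?_)
        ring)
      ((integrable_one_add_norm_rpow d).const_mul _)
      (Eventually.of_forall fun ξ ζ _ => (hg.entire ξ ζ).hasDerivAt)
    exact this.2.differentiableAt
  have hinv : ∀ (ζ : ℂ) (τ : ℝ), Φ (ζ + τ) = Φ ζ := by
    intro ζ τ
    simp only [hΦ]
    rw [← integral_add_right_eq_self (fun ξ => g ξ ζ) (τ • v)]
    simp_rw [hg.shift]
  have hder : S.EqOn (deriv Φ) 0 := by
    intro ζ hζ
    have h1 : HasDerivAt Φ (deriv Φ ζ) ζ := (hD.differentiableAt (hSo.mem_nhds hζ)).hasDerivAt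
    have h2 : HasDerivAt (fun τ : ℝ => Φ (ζ + τ)) (deriv Φ ζ) 0 := by
      have h3 : HasDerivAt (fun τ : ℝ => ζ + (τ : ℂ)) 1 0 :=
        (Complex.ofRealCLM.hasDerivAt (x := (0:ℝ))).const_add ζ
      have h4 : HasDerivAt Φ (deriv Φ ζ) (ζ + ((0:ℝ) : ℂ)) := by simpa using h1
      have h6 := h4.comp (0:ℝ) h3
      rw [mul_one] at h6
      exact h6
    have h5 : HasDerivAt (fun τ : ℝ => Φ (ζ + τ)) 0 0 := by
      simp_rw [hinv]
      exact hasDerivAt_const _ _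
    exact h2.unique h5
  have h0S : (0:ℂ) ∈ S := by simpa [hS] using hR
  have hηS : Complex.I * (η : ℂ) ∈ S := by simpa [hS] using hη
  exact hSo.is_const_of_deriv_eq_zero hSc.isPreconnected hD hder h0S hηS

end EntireAlong

end ContourShift

section HolomorphicWeight

variable {d : ℕ} {M : ℕ → ℝ}

lemma pow_mul_exp_mul_exp_neg_sq_le {c s : ℝ} (hs : 0 ≤ s) (r : ℝ) (m : ℕ) (hc : 1 ≤ c) :
    (2 + 2 * s) ^ m * (Real.exp (r * s) * Real.exp (-(c * s ^ 2))) ≤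
      Real.exp (m * 2 + (|r| + 2 * m + 1) ^ 2) * Real.exp (-(1 * s)) := by
  have h1 : (2 + 2 * s) ^ m ≤ Real.exp (m * (2 + 2 * s)) := by
    rw [Real.exp_nat_mul]
    gcongr
    linarith [Real.add_one_le_exp (2 + 2 * s)]
  have h2 : r * s ≤ |r| * s := by gcongr; exact le_abs_self r
  refine (mul_le_mul_of_nonneg_right h1 (by positivity)).trans ?_
  rw [← Real.exp_add, ← Real.exp_add, ← Real.exp_add]
  refine Real.exp_le_exp.2 ?_
  nlinarith [sq_nonneg (s - (|r| + 2 * m + 1)), sq_nonneg s, sq_nonneg (|r| + 2 * m + 1)]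

lemma integrable_pow_mul_exp_mul_exp_neg_sq (r : ℝ) (m : ℕ) :
    Integrable fun x : Rd d => (2 + 2 * ‖x‖) ^ m *
      (Real.exp (r * ‖x‖) * Real.exp (-(Real.pi * ‖x‖ ^ 2))) := by
  refine ((integrable_exp_neg_norm one_pos).const_mul
    (Real.exp (m * 2 + (|r| + 2 * m + 1) ^ 2))).mono'
    (Continuous.aestronglyMeasurable (by fun_prop)) (Eventually.of_forall fun x => ?_)
  rw [Real.norm_of_nonneg (by positivity)]
  exact pow_mul_exp_mul_exp_neg_sq_le (norm_nonneg x) r m (by linarith [Real.pi_gt_three])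

/-- The Gaussian `e^{-π (u + ζ v)²}`. -/
def gaussShift (v : Rd d) (ζ : ℂ) (u : Rd d) : ℂ :=
  Complex.exp (-(Real.pi : ℂ) * (((‖u‖ ^ 2 : ℝ) : ℂ) + 2 * ζ * ((inner ℝ u v : ℝ) : ℂ) +
    ζ ^ 2 * ((‖v‖ ^ 2 : ℝ) : ℂ)))

lemma gaussShift_eq (v : Rd d) (ζ : ℂ) (u : Rd d) :
    gaussShift v ζ u = Complex.exp (-(Real.pi : ℂ) * (ζ ^ 2 * ((‖v‖ ^ 2 : ℝ) : ℂ))) *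
      Complex.exp (-(Real.pi : ℂ) * (‖u‖ : ℂ) ^ 2 +
        (-(2 * Real.pi * ζ)) * ((inner ℝ v u : ℝ) : ℂ)) := by
  rw [gaussShift, ← Complex.exp_add, real_inner_comm]
  congr 1
  push_cast
  ring

lemma integrable_gaussShift (v : Rd d) (ζ : ℂ) : Integrable (gaussShift v ζ) := by
  have h := GaussianFourier.integrable_cexp_neg_mul_sq_norm_add (V := Rd d)
    (b := (Real.pi : ℂ)) (by simpa using Real.pi_pos) (-(2 * Real.pi * ζ)) v
  exact (h.const_mul _).congr (Eventually.of_forall fun u => (gaussShift_eq v ζ u).symm)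

lemma integral_gaussShift (v : Rd d) (ζ : ℂ) : ∫ u, gaussShift v ζ u = 1 := by
  have hpi : (Real.pi : ℂ) ≠ 0 := by exact_mod_cast Real.pi_ne_zero
  simp_rw [gaussShift_eq]
  rw [integral_const_mul, GaussianFourier.integral_cexp_neg_mul_sq_norm_add
    (by simpa using Real.pi_pos), div_self hpi, Complex.one_cpow, one_mul, ← Complex.exp_add]
  rw [Complex.exp_eq_one_iff]
  refine ⟨0, ?_⟩
  field_simp
  push_cast
  ring

lemma norm_gaussShift_le {v : Rd d} (hv : ‖v‖ ≤ 1) {η R : ℝ} (hη : |η| ≤ R) (u : Rd d) :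
    ‖gaussShift v (Complex.I * η) u‖ ≤
      Real.exp (Real.pi * R ^ 2) * Real.exp (-(Real.pi * ‖u‖ ^ 2)) := by
  rw [gaussShift, Complex.norm_exp, ← Real.exp_add]
  refine Real.exp_le_exp.2 ?_
  have h1 : (-(Real.pi : ℂ) * (((‖u‖ ^ 2 : ℝ) : ℂ) + 2 * (Complex.I * η) *
      ((inner ℝ u v : ℝ) : ℂ) + (Complex.I * η) ^ 2 * ((‖v‖ ^ 2 : ℝ) : ℂ))).re =
      -(Real.pi * ‖u‖ ^ 2) + Real.pi * (η ^ 2 * ‖v‖ ^ 2) := by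
    have : (-(Real.pi : ℂ) * (((‖u‖ ^ 2 : ℝ) : ℂ) + 2 * (Complex.I * η) *
      ((inner ℝ u v : ℝ) : ℂ) + (Complex.I * η) ^ 2 * ((‖v‖ ^ 2 : ℝ) : ℂ))) =
      ((-(Real.pi * ‖u‖ ^ 2) + Real.pi * (η ^ 2 * ‖v‖ ^ 2) : ℝ) : ℂ) +
        ((-(2 * Real.pi * η * inner ℝ u v) : ℝ) : ℂ) * Complex.I := by
      rw [mul_pow, Complex.I_sq]
      push_cast
      ring
    rw [this]
    simp only [Complex.add_re, Complex.re_ofReal_mul, Complex.ofReal_re, Complex.I_re, mul_zero,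
      add_zero]
  rw [h1]
  have h2 : η ^ 2 ≤ R ^ 2 := sq_le_sq' (by linarith [neg_abs_le η]) ((le_abs_self η).trans hη)
  have h3 : ‖v‖ ^ 2 ≤ 1 := pow_le_one₀ (norm_nonneg v) hv
  have h4 : η ^ 2 * ‖v‖ ^ 2 ≤ R ^ 2 := by nlinarith [sq_nonneg η]
  nlinarith [Real.pi_pos]

/-- A function `F` which extends holomorphically to tubes and is comparable there to the
associated function of `M`; the first argument of `F` is the direction of the extension. -/
structure IsHolWeight (M : ℕ → ℝ) (F : Rd d → Rd d → ℂ → ℂ) : Prop where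
  entireAlong : ∀ v, EntireAlong v (F v)
  zero : ∀ v ξ, F v ξ 0 = F 0 ξ 0
  bound : ∀ R : ℝ, ∃ C : ℝ, ∀ v, ‖v‖ ≤ 1 → ∀ (η : ℝ) ξ, |η| ≤ R →
    ‖F v ξ (Complex.I * η) - (nuA M ‖ξ‖ : ℂ)‖ ≤ 1 / 2 * nuA M ‖ξ‖ + C

/-- The associated function of a weight sequence satisfying (M.2)* is close to a function which
extends holomorphically to tubes. -/
lemma M2star.exists_isHolWeight (d : ℕ) (hM : IsWeightSeq M) (h : M2star M) :
    ∃ F : Rd d → Rd d → ℂ → ℂ, IsHolWeight M F := by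
  obtain ⟨D, m₀, hD, hpow⟩ := h.nuA_le_pow hM
  obtain ⟨m, hslow⟩ := h.abs_nuA_sub_le hM
  set w : Rd d → ℝ := fun t => nuA M ‖t‖ with hw
  have hw0 : ∀ t, 0 ≤ w t := fun t => hM.nuA_nonneg (norm_nonneg t)
  have hwm : Measurable w := (measurable_nuA M).comp measurable_norm
  have hwle : ∀ t, w t ≤ D * (2 + 2 * ‖t‖) ^ m₀ := fun t =>
    (hpow _ (norm_nonneg t)).trans (by gcongr <;> linarith [norm_nonneg t])
  set ρ : Rd d → ℂ := fun t => ((w t * Real.exp (-(Real.pi * ‖t‖ ^ 2)) : ℝ) : ℂ) with hρ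
  have hρm : AEStronglyMeasurable ρ :=
    (Complex.measurable_ofReal.comp (hwm.mul (by fun_prop))).aestronglyMeasurable
  have hρi : ∀ r : ℝ, Integrable fun t => Real.exp (r * ‖t‖) * ‖ρ t‖ := by
    intro r
    refine ((integrable_pow_mul_exp_mul_exp_neg_sq r m₀).const_mul D).mono'
      ((Continuous.aestronglyMeasurable (by fun_prop)).mul hρm.norm)
      (Eventually.of_forall fun t => ?_)
    have h0 := hw0 t
    rw [Real.norm_of_nonneg (by positivity), hρ, Complex.norm_real,
      Real.norm_of_nonneg (by positivity)]
    calc Real.exp (r * ‖t‖) * (w t * Real.exp (-(Real.pi * ‖t‖ ^ 2)))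
        ≤ Real.exp (r * ‖t‖) * (D * (2 + 2 * ‖t‖) ^ m₀ * Real.exp (-(Real.pi * ‖t‖ ^ 2))) := by
          gcongr; exact hwle t
      _ = _ := by ring
  set F : Rd d → Rd d → ℂ → ℂ := fun v ξ ζ =>
    Complex.exp (-(Real.pi : ℂ) * (((‖ξ‖ ^ 2 : ℝ) : ℂ) + 2 * ζ * ((inner ℝ ξ v : ℝ) : ℂ) +
      ζ ^ 2 * ((‖v‖ ^ 2 : ℝ) : ℂ))) * ∫ t, ρ t *
      Complex.exp (2 * Real.pi * (((inner ℝ ξ t : ℝ) : ℂ) + ζ * ((inner ℝ v t : ℝ) : ℂ))) with hF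
  have hFk : ∀ v ξ ζ, F v ξ ζ = ∫ u, (w (ξ - u) : ℂ) * gaussShift v ζ u := by
    intro v ξ ζ
    rw [← integral_sub_left_eq_self (fun u => (w (ξ - u) : ℂ) * gaussShift v ζ u) volume ξ, hF]
    dsimp only
    rw [← integral_const_mul]
    congr 1
    ext t
    rw [sub_sub_cancel, hρ, gaussShift]
    dsimp only
    rw [Complex.ofReal_mul, Complex.ofReal_exp]
    have e : ∀ a b c e : ℂ, a * (b * c * e) = b * (a * c * e) := fun a b c e => by ring
    rw [e, ← Complex.exp_add, ← Complex.exp_add, norm_sub_sq_real, inner_sub_left,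
      real_inner_comm v t]
    congr 2
    push_cast
    ring
  refine ⟨F, fun v => ?_, fun v ξ => by simp [hF], fun R => ?_⟩
  · exact ((EntireAlong.normSq.const_mul _).cexp).mul (EntireAlong.laplace hρm hρi _)
  set K : ℝ := Real.exp (Real.pi * R ^ 2) *
    ∫ u : Rd d, (2 + 2 * ‖u‖) ^ m * (Real.exp (0 * ‖u‖) * Real.exp (-(Real.pi * ‖u‖ ^ 2))) with hK
  have hK0 : 0 ≤ K := mul_nonneg (Real.exp_pos _).le (integral_nonneg fun u => by positivity)
  obtain ⟨C, hC, hsl⟩ := hslow (1 / (2 * (K + 1))) (by positivity)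
  refine ⟨C * K, fun v hv η ξ hη => ?_⟩
  have hi1 : Integrable fun u => (w (ξ - u) : ℂ) * gaussShift v (Complex.I * η) u := by
    refine ((integrable_pow_mul_exp_mul_exp_neg_sq 0 m₀).const_mul
      (D * (1 + ‖ξ‖) ^ m₀ * Real.exp (Real.pi * R ^ 2))).mono'
      ((Complex.measurable_ofReal.comp (hwm.comp (by fun_prop))).aestronglyMeasurable.mul
        (integrable_gaussShift v _).aestronglyMeasurable)
      (Eventually.of_forall fun u => ?_)
    rw [norm_mul, Complex.norm_real, Real.norm_of_nonneg (hw0 _)]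
    have h1 : w (ξ - u) ≤ D * ((1 + ‖ξ‖) * (2 + 2 * ‖u‖)) ^ m₀ := by
      refine (hpow _ (norm_nonneg _)).trans ?_
      gcongr
      nlinarith [norm_sub_le ξ u, norm_nonneg ξ, norm_nonneg u,
        mul_nonneg (norm_nonneg ξ) (norm_nonneg u)]
    calc _ ≤ D * ((1 + ‖ξ‖) * (2 + 2 * ‖u‖)) ^ m₀ *
          (Real.exp (Real.pi * R ^ 2) * Real.exp (-(Real.pi * ‖u‖ ^ 2))) := by
          gcongr
          exact norm_gaussShift_le hv hη u
      _ = _ := by rw [mul_pow, zero_mul, Real.exp_zero]; ring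
  have hi2 : Integrable fun u => (w ξ : ℂ) * gaussShift v (Complex.I * η) u :=
    (integrable_gaussShift v _).const_mul _
  have e1 : F v ξ (Complex.I * η) - (w ξ : ℂ) =
      ∫ u, ((w (ξ - u) : ℂ) * gaussShift v (Complex.I * η) u -
        (w ξ : ℂ) * gaussShift v (Complex.I * η) u) := by
    rw [integral_sub hi1 hi2, hFk, integral_const_mul, integral_gaussShift, mul_one]
  change ‖F v ξ (Complex.I * η) - (w ξ : ℂ)‖ ≤ _
  rw [e1]
  have e2 := norm_integral_le_of_norm_le
    (((integrable_pow_mul_exp_mul_exp_neg_sq (d := d) 0 m).const_mul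
      ((1 / (2 * (K + 1)) * w ξ + C) * Real.exp (Real.pi * R ^ 2))))
    (f := fun u => (w (ξ - u) : ℂ) * gaussShift v (Complex.I * η) u -
        (w ξ : ℂ) * gaussShift v (Complex.I * η) u) (Eventually.of_forall fun u => by
      rw [← sub_mul, norm_mul, ← Complex.ofReal_sub, Complex.norm_real, Real.norm_eq_abs]
      have h1 := hsl ‖ξ‖ ‖ξ - u‖ ‖u‖ (norm_nonneg _) (norm_nonneg _) (by
        have := abs_norm_sub_norm_le ξ (ξ - u)
        rwa [sub_sub_cancel] at this)
      have h0 := hw0 ξ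
      calc _ ≤ (1 / (2 * (K + 1)) * w ξ + C) * (2 + 2 * ‖u‖) ^ m *
            (Real.exp (Real.pi * R ^ 2) * Real.exp (-(Real.pi * ‖u‖ ^ 2))) := by
            gcongr
            exact norm_gaussShift_le hv hη u
        _ = _ := by rw [zero_mul, Real.exp_zero]; ring)
  refine e2.trans ?_
  rw [integral_const_mul, mul_assoc, ← hK, add_mul]
  have h0 := hw0 ξ
  have : 1 / (2 * (K + 1)) * w ξ * K ≤ 1 / 2 * w ξ := by
    have h3 : K / (K + 1) ≤ 1 := (div_le_one (by positivity)).2 (by linarith)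
    calc 1 / (2 * (K + 1)) * w ξ * K = 1 / 2 * w ξ * (K / (K + 1)) := by field_simp
      _ ≤ 1 / 2 * w ξ * 1 := by gcongr
      _ = _ := mul_one _
  linarith

end HolomorphicWeight

section KernelFunction

open scoped FourierTransform

variable {d : ℕ} {M : ℕ → ℝ} {F : Rd d → Rd d → ℂ → ℂ}

/-- Exponential decay of an inverse Fourier transform by shifting the contour of integration. -/
lemma EntireAlong.norm_fourierInv_le {g : Rd d → ℂ → ℂ} {x : Rd d}
    (hg : EntireAlong (‖x‖⁻¹ • x) g) {R C : ℝ}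
    (hb : ∀ (η : ℝ) ξ, |η| ≤ R →
      ‖g ξ (Complex.I * η)‖ ≤ C * (1 + ‖ξ‖) ^ (-((d + 1 : ℕ) : ℝ)))
    {η : ℝ} (hη : |η| < R) :
    ‖𝓕⁻ (fun ξ => g ξ 0) x‖ ≤ C * (∫ ξ : Rd d, (1 + ‖ξ‖) ^ (-((d + 1 : ℕ) : ℝ))) *
      Real.exp (-(2 * Real.pi * η * ‖x‖)) := by
  have hvx : inner ℝ (‖x‖⁻¹ • x) x = ‖x‖ := by
    rw [inner_smul_left, real_inner_self_eq_norm_sq, conj_trivial, sq, ← mul_assoc]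
    by_cases h : ‖x‖ = 0
    · simp [h]
    · rw [inv_mul_cancel₀ h, one_mul]
  have hv : ‖‖x‖⁻¹ • x‖ ≤ 1 := by
    rw [norm_smul, norm_inv, norm_norm]
    exact inv_mul_le_one
  have hG : EntireAlong (‖x‖⁻¹ • x) fun ξ ζ => Complex.exp (2 * Real.pi * Complex.I *
      (((inner ℝ ξ x : ℝ) : ℂ) + ζ * ((inner ℝ (‖x‖⁻¹ • x) x : ℝ) : ℂ))) * g ξ ζ :=
    ((EntireAlong.inner_right x).const_mul _).cexp.mul hg
  have hn : ∀ (η : ℝ) (ξ : Rd d), ‖Complex.exp (2 * Real.pi * Complex.I *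
      (((inner ℝ ξ x : ℝ) : ℂ) + (Complex.I * η) * ((inner ℝ (‖x‖⁻¹ • x) x : ℝ) : ℂ)))‖ =
      Real.exp (-(2 * Real.pi * η * ‖x‖)) := by
    intro η ξ
    rw [hvx, Complex.norm_exp]
    have : 2 * Real.pi * Complex.I *
        (((inner ℝ ξ x : ℝ) : ℂ) + (Complex.I * η) * (‖x‖ : ℂ)) =
        ((-(2 * Real.pi * η * ‖x‖) : ℝ) : ℂ) +
          ((2 * Real.pi * inner ℝ ξ x : ℝ) : ℂ) * Complex.I := by
      have := Complex.I_sq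
      push_cast
      linear_combination (2 * Real.pi * η * ‖x‖) * this
    rw [this]
    simp only [Complex.add_re, Complex.re_ofReal_mul, Complex.ofReal_re, Complex.I_re, mul_zero,
      add_zero]
  have h1 := hG.integral_shift hv (R := R) (C := Real.exp (2 * Real.pi * R * ‖x‖) * C)
    (fun η ξ hη => by
      rw [norm_mul, hn, mul_assoc (Real.exp _) C]
      refine mul_le_mul (Real.exp_le_exp.2 ?_) (hb η ξ hη) (norm_nonneg _) (Real.exp_pos _).le
      have h2 : -η ≤ R := (neg_le_abs η).trans hη
      have h3 : 0 ≤ 2 * Real.pi * ‖x‖ := by positivity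
      nlinarith [mul_le_mul_of_nonneg_left h2 h3]) hη
  have h2 : 𝓕⁻ (fun ξ => g ξ 0) x = ∫ ξ, Complex.exp (2 * Real.pi * Complex.I *
      (((inner ℝ ξ x : ℝ) : ℂ) + 0 * ((inner ℝ (‖x‖⁻¹ • x) x : ℝ) : ℂ))) * g ξ 0 := by
    rw [Real.fourierInv_eq']
    congr 1
    ext ξ
    rw [smul_eq_mul]
    congr 2
    push_cast
    ring
  rw [h2, h1]
  refine (norm_integral_le_of_norm_le (((integrable_one_add_norm_rpow d).const_mul C).const_mul
    (Real.exp (-(2 * Real.pi * η * ‖x‖)))) (Eventually.of_forall fun ξ => ?_)).trans (le_of_eq ?_)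
  · rw [norm_mul, hn]
    gcongr
    exact hb η ξ hη.le
  · rw [integral_const_mul, integral_const_mul]
    ring

namespace IsHolWeight

lemma continuous (hF : IsHolWeight M F) : Continuous fun ξ => F 0 ξ 0 :=
  (hF.entireAlong 0).cont 0

lemma norm_cexp_neg_le (hF : IsHolWeight M F) {l : ℝ} (hl : 0 < l) (R : ℝ) :
    ∃ C : ℝ, 0 < C ∧ ∀ v, ‖v‖ ≤ 1 → ∀ (η : ℝ) ξ, |η| ≤ R →
      ‖Complex.exp (-(l : ℂ) * F v ξ (Complex.I * η))‖ ≤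
        C * Real.exp (-(l / 2 * nuA M ‖ξ‖)) := by
  obtain ⟨C, hC⟩ := hF.bound R
  refine ⟨Real.exp (l * C), Real.exp_pos _, fun v hv η ξ hη => ?_⟩
  have h1 := (Complex.abs_re_le_norm _).trans (hC v hv η ξ hη)
  rw [Complex.sub_re, Complex.ofReal_re] at h1
  have h2 := (abs_le.1 h1).1
  rw [Complex.norm_exp, ← Real.exp_add, ← Complex.ofReal_neg, Complex.re_ofReal_mul]
  refine Real.exp_le_exp.2 ?_
  nlinarith

lemma norm_cexp_le (hF : IsHolWeight M F) {l : ℝ} (hl : 0 < l) (R : ℝ) :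
    ∃ C : ℝ, 0 < C ∧ ∀ v, ‖v‖ ≤ 1 → ∀ (η : ℝ) ξ, |η| ≤ R →
      ‖Complex.exp ((l : ℂ) * F v ξ (Complex.I * η))‖ ≤
        C * Real.exp (l * (3 / 2) * nuA M ‖ξ‖) := by
  obtain ⟨C, hC⟩ := hF.bound R
  refine ⟨Real.exp (l * C), Real.exp_pos _, fun v hv η ξ hη => ?_⟩
  have h1 := (Complex.abs_re_le_norm _).trans (hC v hv η ξ hη)
  rw [Complex.sub_re, Complex.ofReal_re] at h1
  have h2 := (abs_le.1 h1).2
  rw [Complex.norm_exp, ← Real.exp_add, Complex.re_ofReal_mul]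
  refine Real.exp_le_exp.2 ?_
  nlinarith

end IsHolWeight

lemma HasMoments.pD_fourierInv {g : Rd d → ℂ} (hg : HasMoments g) (α : Fin d → ℕ) :
    pD α (𝓕⁻ g) = 𝓕⁻ (fun ξ => (∏ j, (2 * Real.pi * Complex.I * (ξ j : ℂ)) ^ α j) * g ξ) := by
  suffices HasMoments (fun ξ => (∏ j, (2 * Real.pi * Complex.I * (ξ j : ℂ)) ^ α j) * g ξ) ∧
      pD α (𝓕⁻ g) = 𝓕⁻ (fun ξ => (∏ j, (2 * Real.pi * Complex.I * (ξ j : ℂ)) ^ α j) * g ξ) from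
    this.2
  induction α using multiindex_induction with
  | h0 => simpa using hg
  | hs α j ih =>
    have e : (fun ξ : Rd d => (∏ i, (2 * Real.pi * Complex.I * (ξ i : ℂ)) ^
        (α + Pi.single j 1 : Fin d → ℕ) i) * g ξ) = fun ξ => 2 * Real.pi * Complex.I * (ξ j : ℂ) *
        ((∏ i, (2 * Real.pi * Complex.I * (ξ i : ℂ)) ^ α i) * g ξ) := by
      ext ξ
      simp_rw [Pi.add_apply, pow_add]
      rw [Finset.prod_mul_distrib, Finset.prod_eq_single (f := fun i =>
        (2 * Real.pi * Complex.I * (ξ i : ℂ)) ^ (Pi.single j 1 : Fin d → ℕ) i) j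
        (fun i _ hi => by simp [hi]) (by simp)]
      rw [Pi.single_eq_same, pow_one]
      ring
    rw [e]
    exact ⟨ih.1.coord_mul j, by
      rw [pD_add_single hg.contDiff_fourierInv, ih.2, ih.1.dop_fourierInv]⟩

lemma M2.exists_exp_neg_mul_nuA_le (hM : IsWeightSeq M) (h2 : M2 M) {l : ℝ} (hl : 0 < l)
    (p : ℕ) : ∃ C : ℝ, 0 < C ∧ ∀ t, 0 ≤ t →
      Real.exp (-(l * nuA M t)) ≤ C * (1 + t) ^ (-(p : ℝ)) := by
  obtain ⟨C, hC, h⟩ := h2.exists_pow_mul_exp_le hM hl p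
  refine ⟨C, hC, fun t ht => ?_⟩
  have h5 : 0 < (1 + t) ^ p := by positivity
  rw [Real.rpow_neg (by positivity), Real.rpow_natCast, ← div_eq_mul_inv, le_div_iff₀ h5, mul_comm]
  exact h t ht

lemma M2.exists_pow_mul_exp_neg_nuA_le (hM : IsWeightSeq M) (h2 : M2 M) {l : ℝ} (hl : 0 < l)
    (d : ℕ) : ∃ K : ℝ, 0 < K ∧ ∀ R : ℝ, 0 ≤ R → ∃ C : ℝ, 0 < C ∧ ∀ (n : ℕ) (t : ℝ), 0 ≤ t →
      (2 * Real.pi * (t + R)) ^ n * Real.exp (-(l * nuA M t)) ≤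
        C * K ^ n * M n * (1 + t) ^ (-((d + 1 : ℕ) : ℝ)) := by
  obtain ⟨C₁, hC₁, h1⟩ := h2.exists_exp_neg_mul_nuA_le hM (half_pos hl) (d + 1)
  obtain ⟨K, C₂, hK, hdiv⟩ := h2.nuA_div_le hM (half_pos hl)
  refine ⟨4 * Real.pi * K, by positivity, fun R hR =>
    ⟨(Real.exp C₂ + Real.exp (nuA M R)) * C₁, by positivity, fun n t ht => ?_⟩⟩
  have hMn := hM.pos n
  have e1 : (t + R) ^ n ≤ 2 ^ n * (t ^ n + R ^ n) := by
    rcases le_total t R with h | h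
    · calc (t + R) ^ n ≤ (2 * R) ^ n := by gcongr; linarith
        _ = 2 ^ n * R ^ n := mul_pow _ _ _
        _ ≤ _ := by gcongr; linarith [pow_nonneg ht n]
    · calc (t + R) ^ n ≤ (2 * t) ^ n := by gcongr; linarith
        _ = 2 ^ n * t ^ n := mul_pow _ _ _
        _ ≤ _ := by gcongr; linarith [pow_nonneg hR n]
  have e2 : R ^ n * Real.exp (-(l / 2 * nuA M t)) ≤ K ^ n * M n * Real.exp (nuA M R) := by
    have : Real.exp (-(l / 2 * nuA M t)) ≤ 1 := Real.exp_le_one_iff.2 (by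
      have := hM.nuA_nonneg ht
      have : 0 ≤ l / 2 * nuA M t := by positivity
      linarith)
    have hKn : 1 ≤ K ^ n := one_le_pow₀ hK
    calc _ ≤ (M n * Real.exp (nuA M R)) * 1 := by
          gcongr
          exact hM.pow_le hR n
      _ ≤ (M n * Real.exp (nuA M R)) * K ^ n := by gcongr
      _ = _ := by ring
  have e3 : t ^ n * Real.exp (-(l / 2 * nuA M t)) ≤ K ^ n * M n * Real.exp C₂ := by
    have hK0 : 0 < K := by linarith
    have h3 := hM.pow_le (t := t / K) (by positivity) n
    have h4 : Real.exp (nuA M (t / K)) ≤ Real.exp (l / 2 * nuA M t + C₂) :=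
      Real.exp_le_exp.2 (hdiv t ht)
    calc _ = K ^ n * (t / K) ^ n * Real.exp (-(l / 2 * nuA M t)) := by
          rw [← mul_pow, mul_div_cancel₀ _ hK0.ne']
      _ ≤ K ^ n * (M n * Real.exp (l / 2 * nuA M t + C₂)) * Real.exp (-(l / 2 * nuA M t)) := by
          gcongr
          exact h3.trans (by gcongr)
      _ = K ^ n * M n * (Real.exp (l / 2 * nuA M t + C₂) * Real.exp (-(l / 2 * nuA M t))) := by ring
      _ = _ := by rw [← Real.exp_add]; congr 2; ring
  have e4 := h1 t ht
  calc (2 * Real.pi * (t + R)) ^ n * Real.exp (-(l * nuA M t))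
      = (2 * Real.pi) ^ n * (t + R) ^ n *
        (Real.exp (-(l / 2 * nuA M t)) * Real.exp (-(l / 2 * nuA M t))) := by
        rw [← Real.exp_add, mul_pow]; congr 2; ring
    _ ≤ (2 * Real.pi) ^ n * (2 ^ n * (t ^ n + R ^ n)) *
        (Real.exp (-(l / 2 * nuA M t)) * Real.exp (-(l / 2 * nuA M t))) := by gcongr
    _ = (2 * Real.pi) ^ n * 2 ^ n * ((t ^ n * Real.exp (-(l / 2 * nuA M t)) +
        R ^ n * Real.exp (-(l / 2 * nuA M t))) * Real.exp (-(l / 2 * nuA M t))) := by ring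
    _ ≤ (2 * Real.pi) ^ n * 2 ^ n * ((K ^ n * M n * Real.exp C₂ +
        K ^ n * M n * Real.exp (nuA M R)) * (C₁ * (1 + t) ^ (-((d + 1 : ℕ) : ℝ)))) := by gcongr
    _ = _ := by
      have : 4 * Real.pi * K = 2 * Real.pi * 2 * K := by ring
      rw [this, mul_pow _ K, mul_pow _ (2:ℝ)]
      ring

namespace IsHolWeight

lemma hasMoments (hM : IsWeightSeq M) (h2 : M2 M) (hF : IsHolWeight M F) {l : ℝ} (hl : 0 < l) :
    HasMoments fun ξ => Complex.exp (-(l : ℂ) * F 0 ξ 0) := by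
  obtain ⟨C, -, hC⟩ := hF.norm_cexp_neg_le hl 0
  refine h2.hasMoments hM (half_pos hl)
    (Complex.continuous_exp.comp (continuous_const.mul hF.continuous)).aestronglyMeasurable
    (C := C) fun ξ => ?_
  simpa using hC 0 (by simp) 0 ξ (by simp)

/-- The functions `𝓕⁻ (e^{-l F})` belong to `𝒦^{{M}}`. -/
lemma kRou (hM : IsWeightSeq M) (h2 : M2 M) (hF : IsHolWeight M F) {l : ℝ} (hl : 0 < l) :
    KRou d M (𝓕⁻ fun ξ => Complex.exp (-(l : ℂ) * F 0 ξ 0)) := by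
  have hmom := hF.hasMoments hM h2 hl
  obtain ⟨K, hK, hpow⟩ := h2.exists_pow_mul_exp_neg_nuA_le hM (half_pos hl) d
  refine ⟨hmom.contDiff_fourierInv, K⁻¹, inv_pos.2 hK, fun n => ?_⟩
  have hn0 : (0:ℝ) ≤ n := Nat.cast_nonneg n
  obtain ⟨C₁, hC₁, h1⟩ := hpow (n + 1) (by positivity)
  obtain ⟨C₃, hC₃, h3⟩ := hF.norm_cexp_neg_le hl (n + 1)
  set J : ℝ := ∫ ξ : Rd d, (1 + ‖ξ‖) ^ (-((d + 1 : ℕ) : ℝ)) with hJ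
  have hJ0 : 0 ≤ J := integral_nonneg fun ξ => by positivity
  refine ⟨C₁ * C₃ * J, fun α x => ?_⟩
  set v : Rd d := ‖x‖⁻¹ • x with hv
  have hv1 : ‖v‖ ≤ 1 := by
    rw [hv, norm_smul, norm_inv, norm_norm]
    exact inv_mul_le_one
  have hg : EntireAlong v fun ξ ζ => (∏ j, (2 * Real.pi * Complex.I *
      (((ξ j : ℝ) : ℂ) + ζ * ((v j : ℝ) : ℂ))) ^ α j) * Complex.exp (-(l : ℂ) * F v ξ ζ) :=
    (EntireAlong.prod _ fun j => ((EntireAlong.coord j).const_mul _).pow _).mul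
      ((hF.entireAlong v).const_mul _).cexp
  have hb : ∀ (η : ℝ) ξ, |η| ≤ (n + 1 : ℝ) → ‖(∏ j, (2 * Real.pi * Complex.I *
      (((ξ j : ℝ) : ℂ) + (Complex.I * η) * ((v j : ℝ) : ℂ))) ^ α j) *
        Complex.exp (-(l : ℂ) * F v ξ (Complex.I * η))‖ ≤
      (C₁ * C₃ * K ^ msize α * M (msize α)) * (1 + ‖ξ‖) ^ (-((d + 1 : ℕ) : ℝ)) := by
    intro η ξ hη
    have hp : ‖∏ j, (2 * Real.pi * Complex.I *
        (((ξ j : ℝ) : ℂ) + (Complex.I * η) * ((v j : ℝ) : ℂ))) ^ α j‖ ≤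
        (2 * Real.pi * (‖ξ‖ + (n + 1))) ^ msize α := by
      rw [norm_prod, msize, ← Finset.prod_pow_eq_pow_sum]
      refine Finset.prod_le_prod (fun j _ => norm_nonneg _) fun j _ => ?_
      rw [norm_pow]
      gcongr
      rw [norm_mul, norm_mul, norm_mul, Complex.norm_I, Complex.norm_ofNat, Complex.norm_real,
        Real.norm_of_nonneg Real.pi_pos.le, mul_one]
      gcongr
      refine (norm_add_le _ _).trans ?_
      rw [norm_mul, norm_mul, Complex.norm_I, one_mul, Complex.norm_real, Complex.norm_real,
        Complex.norm_real]
      have hvj : ‖v j‖ ≤ 1 := (PiLp.norm_apply_le v j).trans hv1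
      refine add_le_add (PiLp.norm_apply_le ξ j) ?_
      calc ‖η‖ * ‖v j‖ ≤ (n + 1) * 1 := by
            gcongr
            exact hη
        _ = _ := mul_one _
    rw [norm_mul]
    calc _ ≤ (2 * Real.pi * (‖ξ‖ + (n + 1))) ^ msize α *
          (C₃ * Real.exp (-(l / 2 * nuA M ‖ξ‖))) :=
          mul_le_mul hp (h3 v hv1 η ξ hη) (norm_nonneg _) (by positivity)
      _ = C₃ * ((2 * Real.pi * (‖ξ‖ + (n + 1))) ^ msize α *
          Real.exp (-(l / 2 * nuA M ‖ξ‖))) := by ring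
      _ ≤ C₃ * (C₁ * K ^ msize α * M (msize α) * (1 + ‖ξ‖) ^ (-((d + 1 : ℕ) : ℝ))) := by
          exact mul_le_mul_of_nonneg_left (h1 _ _ (norm_nonneg ξ)) hC₃.le
      _ = _ := by ring
  have key := hg.norm_fourierInv_le hb (η := n) (by rw [abs_of_nonneg hn0]; linarith)
  have e : pD α (𝓕⁻ fun ξ => Complex.exp (-(l : ℂ) * F 0 ξ 0)) =
      𝓕⁻ (fun ξ => (∏ j, (2 * Real.pi * Complex.I *
      (((ξ j : ℝ) : ℂ) + 0 * ((v j : ℝ) : ℂ))) ^ α j) * Complex.exp (-(l : ℂ) * F v ξ 0)) := by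
    rw [hmom.pD_fourierInv]
    simp_rw [zero_mul, add_zero, hF.zero v]
  rw [e]
  have hexp : Real.exp (-(2 * Real.pi * n * ‖x‖)) ≤ Real.exp (-(n * ‖x‖)) := by
    refine Real.exp_le_exp.2 (neg_le_neg ?_)
    have h6 : (1:ℝ) ≤ 2 * Real.pi := by linarith [Real.pi_gt_three]
    have h7 : 0 ≤ n * ‖x‖ := by positivity
    nlinarith [mul_le_mul_of_nonneg_right h6 h7]
  have hMp := hM.pos (msize α)
  calc _ ≤ K⁻¹ ^ msize α * (C₁ * C₃ * K ^ msize α * M (msize α) * J *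
        Real.exp (-(2 * Real.pi * n * ‖x‖))) * Real.exp (n * ‖x‖) := by
        gcongr
    _ ≤ K⁻¹ ^ msize α * (C₁ * C₃ * K ^ msize α * M (msize α) * J *
        Real.exp (-(n * ‖x‖))) * Real.exp (n * ‖x‖) := by gcongr
    _ = (K⁻¹ * K) ^ msize α * (C₁ * C₃ * J * M (msize α) *
        (Real.exp (-(n * ‖x‖)) * Real.exp (n * ‖x‖))) := by rw [mul_pow]; ring
    _ = _ := by rw [inv_mul_cancel₀ hK.ne', one_pow, ← Real.exp_add]; simp

end IsHolWeight

lemma KRou.exists_norm_le {f : Rd d → ℂ} (hM : IsWeightSeq M) (hf : KRou d M f) :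
    ∃ K : ℝ, 0 < K ∧ ∀ n : ℕ, ∃ C : ℝ, 0 ≤ C ∧ ∀ (α : Fin d → ℕ) x,
      ‖pD α f x‖ ≤ C * K ^ msize α * M (msize α) * Real.exp (-(n * ‖x‖)) := by
  obtain ⟨-, k, hk, h⟩ := hf
  refine ⟨k⁻¹, inv_pos.2 hk, fun n => ?_⟩
  obtain ⟨C, hC⟩ := h n
  refine ⟨C, ?_, fun α x => ?_⟩
  · have := hC 0 0
    have h1 : 0 ≤ k ^ msize (0 : Fin d → ℕ) * ‖pD 0 f 0‖ * Real.exp (n * ‖(0 : Rd d)‖) := by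
      positivity
    exact nonneg_of_mul_nonneg_left (h1.trans this) (hM.pos _)
  · have := hC α x
    have hkp : 0 < k ^ msize α := by positivity
    rw [inv_pow, Real.exp_neg]
    calc ‖pD α f x‖ = k ^ msize α * ‖pD α f x‖ * Real.exp (n * ‖x‖) *
          ((k ^ msize α)⁻¹ * (Real.exp (n * ‖x‖))⁻¹) := by field_simp
      _ ≤ C * M (msize α) * ((k ^ msize α)⁻¹ * (Real.exp (n * ‖x‖))⁻¹) := by gcongr
      _ = _ := by ring

lemma KRou.integrable {f : Rd d → ℂ} (hM : IsWeightSeq M) (hf : KRou d M f) : Integrable f := by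
  obtain ⟨K, hK, h⟩ := hf.exists_norm_le hM
  obtain ⟨C, hC, h1⟩ := h 1
  refine ((integrable_exp_neg_norm one_pos).const_mul C).mono'
    hf.1.continuous.aestronglyMeasurable (Eventually.of_forall fun x => ?_)
  simpa [hM.2.1] using h1 0 x

lemma IsHolWeight.fourier_kernel (hM : IsWeightSeq M) (h2 : M2 M) (hF : IsHolWeight M F) {l : ℝ}
    (hl : 0 < l) : 𝓕 (𝓕⁻ fun ξ => Complex.exp (-(l : ℂ) * F 0 ξ 0)) =
      fun ξ => Complex.exp (-(l : ℂ) * F 0 ξ 0) := by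
  refine Continuous.fourier_fourierInv_eq
    (Complex.continuous_exp.comp (continuous_const.mul hF.continuous))
    (hF.hasMoments hM h2 hl).integrable ?_
  have := ((hF.kRou hM h2 hl).integrable hM).comp_neg
  simpa [Real.fourierInv_eq_fourier_neg] using this

end KernelFunction

section Localization

open scoped FourierTransform

variable {d : ℕ} {M A : ℕ → ℝ} {K h C : ℝ} {φ ψ : Rd d → ℂ}

/-- Quantitative membership in `𝒮^{{M}}_{{A}}`. -/
def GSBound (M A : ℕ → ℝ) (K h C : ℝ) (φ : Rd d → ℂ) : Prop :=
  ContDiff ℝ (⊤ : ℕ∞) φ ∧ ∀ (α : Fin d → ℕ) x,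
    ‖pD α φ x‖ ≤ C * K ^ msize α * M (msize α) * Real.exp (-nuA A (h * ‖x‖))

namespace GSBound

lemma nonneg (hA : IsWeightSeq A) (hM : IsWeightSeq M) (hφ : GSBound M A K h C φ) : 0 ≤ C := by
  have := (norm_nonneg _).trans (hφ.2 0 0)
  simpa [hM.2.1, hA.nuA_zero] using this

lemma norm_le (hM : IsWeightSeq M) (hφ : GSBound M A K h C φ) (x : Rd d) :
    ‖φ x‖ ≤ C * Real.exp (-nuA A (h * ‖x‖)) := by
  simpa [hM.2.1] using hφ.2 0 x

lemma norm_dop_iterate_le (hφ : GSBound M A K h C φ) (j : Fin d) (n : ℕ) (x : Rd d) :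
    ‖(dop j)^[n] φ x‖ ≤ C * K ^ n * M n * Real.exp (-nuA A (h * ‖x‖)) := by
  rw [← pD_single hφ.1]
  simpa using hφ.2 (Pi.single j n) x

lemma integrable (hM : IsWeightSeq M) (hA : IsWeightSeq A) (hA2 : M2 A) (hh : 0 < h)
    (hφ : GSBound M A K h C φ) : Integrable φ :=
  ((hA2.integrable_exp_neg_nuA hA hh).const_mul C).mono' hφ.1.continuous.aestronglyMeasurable
    (Eventually.of_forall (hφ.norm_le hM))

lemma mono_weight (hM : IsWeightSeq M) (hA : IsWeightSeq A) {h' : ℝ} (hK : 0 ≤ K) (hh : 0 ≤ h')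
    (hle : h' ≤ h) (hφ : GSBound M A K h C φ) : GSBound M A K h' C φ := by
  refine ⟨hφ.1, fun α x => (hφ.2 α x).trans ?_⟩
  have hC := hφ.nonneg hA hM
  have := hM.pos (msize α)
  gcongr
  exact hA.nuA_mono (by positivity) (by gcongr)

/-- Derivatives of functions with Gelfand–Shilov bounds satisfy such bounds. -/
lemma pD (hM : IsWeightSeq M) (hA : IsWeightSeq A) {C₀ H : ℝ} (h2 : HasM2 M C₀ H) (hK : 0 ≤ K)
    (hφ : GSBound M A K h C φ) (β : Fin d → ℕ) :
    GSBound M A (K * H) h (C * (C₀ * (K * H) ^ msize β * M (msize β))) (pD β φ) := by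
  refine ⟨contDiff_pD hφ.1 β, fun α x => ?_⟩
  have hC := hφ.nonneg hA hM
  rw [pD_pD hφ.1]
  refine (hφ.2 _ x).trans ?_
  rw [msize_add]
  calc _ ≤ C * K ^ (msize α + msize β) *
        (C₀ * H ^ (msize α + msize β) * M (msize α) * M (msize β)) *
          Real.exp (-nuA A (h * ‖x‖)) := by
        gcongr
        exact h2.2.2 _ _
    _ = _ := by rw [pow_add, pow_add, mul_pow, mul_pow]; ring

/-- Decay of the Fourier transform. -/
lemma norm_fourier_le (hM : IsWeightSeq M) (hA : IsWeightSeq A) (hA2 : M2 A) (hK : 0 < K)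
    (hh : 0 < h) (hφ : GSBound M A K h C φ) (ξ : Rd d) :
    ‖𝓕 φ ξ‖ ≤ C * (∫ x : Rd d, Real.exp (-nuA A (h * ‖x‖))) *
      Real.exp (-nuA M (‖ξ‖ / (K * (d + 1)))) := by
  refine (hM.norm_fourier_le hφ.1 hK ((hA2.integrable_exp_neg_nuA hA hh).const_mul C)
    (hφ.norm_le hM) (fun j n x => ?_) ξ).trans (le_of_eq ?_)
  · refine (hφ.norm_dop_iterate_le j n x).trans (le_of_eq (by ring))
  · rw [integral_const_mul]

end GSBound

lemma GSBound.localized_bound (hM : IsWeightSeq M) (hA : IsWeightSeq A) (hfact : factSubset A)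
    (hψ : KRou d M ψ) (hK : 0 < K) (hh : 0 < h) :
    ∃ K₂ h₁ D : ℝ, 0 < K₂ ∧ 0 < h₁ ∧ 0 ≤ D ∧
    (∀ x : Rd d, Real.exp (nuA A (h₁ * ‖x‖)) ≤ D * Real.exp (1 / 2 * ‖x‖)) ∧
    ∀ (φ : Rd d → ℂ) (C : ℝ), GSBound M A K h C φ → ∀ (s v : Rd d) (η : ℝ), ‖v‖ ≤ 1 → |η| ≤ 2 →
      ∀ y : Rd d, ‖φ (y - s) * ψ y * Complex.exp ((2 * Real.pi * η * inner ℝ v (y - 0) : ℝ) : ℂ)‖ ≤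
          C * D * Real.exp (-nuA A (h₁ * ‖s‖)) * Real.exp (-(1 * ‖y‖)) ∧
        ∀ (j : Fin d) (n : ℕ), ‖(dop j)^[n] (fun y => φ (y - s) * ψ y *
          Complex.exp ((2 * Real.pi * η * inner ℝ v (y - 0) : ℝ) : ℂ)) y‖ ≤
        K₂ ^ n * M n * (C * D * Real.exp (-nuA A (h₁ * ‖s‖)) * Real.exp (-(1 * ‖y‖))) := by
  obtain ⟨Cf, L, hCf, hL, hexp⟩ := hfact.exp_nuA_le hA
  obtain ⟨Kψ, hKψ, hψb⟩ := hψ.exists_norm_le hM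
  obtain ⟨Cψ, hCψ, hψb⟩ := hψb 15
  have hL0 : 0 < L := by linarith
  set k : ℝ := min h L⁻¹ with hk
  have hk0 : 0 < k := lt_min hh (inv_pos.2 hL0)
  have hkL : L * k ≤ 1 := by
    calc L * k ≤ L * L⁻¹ := by gcongr; exact min_le_right _ _
      _ = 1 := mul_inv_cancel₀ hL0.ne'
  refine ⟨K + Kψ + 13, k / 2, Cf * Cψ + Cf, by positivity, by positivity, by positivity,
    fun x => ?_, ?_⟩
  · refine (hexp _ (by positivity)).trans ?_
    have h1 : Cf ≤ Cf * Cψ + Cf := by nlinarith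
    have h2 : L * (k / 2 * ‖x‖) ≤ 1 / 2 * ‖x‖ := by
      calc _ = (L * k) * (1 / 2 * ‖x‖) := by ring
        _ ≤ 1 * (1 / 2 * ‖x‖) := by gcongr
        _ = _ := one_mul _
    gcongr
  intro φ C hφ s v η hv hη y
  have hC := hφ.nonneg hA hM
  have hφ' := hφ.mono_weight hM hA hK.le hk0.le (min_le_left _ _)
  have hc : |2 * Real.pi * η| ≤ 13 := by
    rw [abs_mul, abs_of_pos (by positivity)]
    nlinarith [Real.pi_lt_d2, Real.pi_pos, abs_nonneg η]
  have hcv : ∀ z : Rd d, 2 * Real.pi * η * inner ℝ v z ≤ 13 * ‖z‖ := by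
    intro z
    refine (le_abs_self _).trans ?_
    rw [abs_mul]
    gcongr
    exact (abs_real_inner_le_norm v z).trans (by nlinarith [norm_nonneg z])
  have h1 : ∀ j n, ‖(dop j)^[n] (fun y => φ (y - s)) y‖ ≤
      (C * Real.exp (-nuA A (k * ‖y - s‖))) * K ^ n * M n := fun j n => by
    rw [dop_iterate_comp_sub_right]
    exact (hφ'.norm_dop_iterate_le j n _).trans (le_of_eq (by ring))
  have h2 : ∀ j n, ‖(dop j)^[n] ψ y‖ ≤ (Cψ * Real.exp (-(15 * ‖y‖))) * Kψ ^ n * M n := fun j n => by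
    rw [← pD_single hψ.1]
    have := hψb (Pi.single j n) y
    rw [msize_single] at this
    exact this.trans (le_of_eq (by push_cast; ring))
  have h3 : ∀ j n, ‖(dop j)^[n] (fun y => Complex.exp
      ((2 * Real.pi * η * inner ℝ v (y - 0) : ℝ) : ℂ)) y‖ ≤
      Real.exp (13 * ‖y‖) * 13 ^ n * M n := fun j n => by
    rw [dop_iterate_cexp_inner, norm_mul, Complex.norm_real, Complex.norm_exp, Complex.ofReal_re,
      norm_pow, sub_zero, mul_comm, ← mul_one (_ * _)]
    have hvj : ‖v j‖ ≤ 1 := (PiLp.norm_apply_le v j).trans hv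
    have hb : ‖2 * Real.pi * η * v j‖ ≤ 13 := by
      rw [norm_mul]
      calc _ ≤ 13 * 1 := mul_le_mul hc hvj (norm_nonneg _) (by norm_num)
        _ = _ := mul_one _
    have h1n := hM.one_le n
    exact mul_le_mul (mul_le_mul (Real.exp_le_exp.2 (hcv y))
      (pow_le_pow_left₀ (norm_nonneg _) hb n) (by positivity) (by positivity)) h1n zero_le_one
      (by positivity)
  have h12 : ContDiff ℝ (⊤ : ℕ∞) fun y => φ (y - s) := hφ.1.comp (by fun_prop)
  have hexpc : ContDiff ℝ (⊤ : ℕ∞) fun y : Rd d => Complex.exp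
      ((2 * Real.pi * η * inner ℝ v (y - 0) : ℝ) : ℂ) :=
    (Complex.ofRealCLM.contDiff.comp (contDiff_const.mul
      (contDiff_const.inner ℝ (contDiff_id.sub contDiff_const)))).cexp
  have e3 : Real.exp (-nuA A (k * ‖y - s‖)) ≤
      Cf * Real.exp (1 * ‖y‖) * Real.exp (-nuA A (k / 2 * ‖s‖)) := by
    have h5 := hA.exp_neg_nuA_mul_le hk0.le s (s - y)
    rw [sub_sub_cancel, norm_sub_rev s y] at h5
    refine h5.trans ?_
    gcongr
    refine (hexp _ (by positivity)).trans ?_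
    rw [← mul_assoc L k]
    gcongr
  have hsplit : Real.exp (1 * ‖y‖) * Real.exp (-(15 * ‖y‖)) * Real.exp (13 * ‖y‖) =
      Real.exp (-(1 * ‖y‖)) := by
    rw [← Real.exp_add, ← Real.exp_add]; congr 1; ring
  have e4 : C * Real.exp (-nuA A (k * ‖y - s‖)) * (Cψ * Real.exp (-(15 * ‖y‖))) *
      Real.exp (13 * ‖y‖) ≤ C * (Cf * Cψ + Cf) * Real.exp (-nuA A (k / 2 * ‖s‖)) *
        Real.exp (-(1 * ‖y‖)) := by
    calc _ ≤ C * (Cf * Real.exp (1 * ‖y‖) * Real.exp (-nuA A (k / 2 * ‖s‖))) *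
          (Cψ * Real.exp (-(15 * ‖y‖))) * Real.exp (13 * ‖y‖) := by gcongr
      _ = C * (Cf * Cψ) * Real.exp (-nuA A (k / 2 * ‖s‖)) *
          (Real.exp (1 * ‖y‖) * Real.exp (-(15 * ‖y‖)) * Real.exp (13 * ‖y‖)) := by ring
      _ ≤ _ := by
        rw [hsplit]
        gcongr
        linarith
  refine ⟨?_, fun j n => ?_⟩
  · refine le_trans ?_ e4
    rw [norm_mul, norm_mul, Complex.norm_exp, Complex.ofReal_re, sub_zero]
    have h4 : ‖ψ y‖ ≤ Cψ * Real.exp (-(15 * ‖y‖)) := by simpa [hM.2.1] using hψb 0 y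
    exact mul_le_mul (mul_le_mul (hφ'.norm_le hM _) h4 (norm_nonneg _) (by positivity))
      (Real.exp_le_exp.2 (hcv y)) (Real.exp_pos _).le (by positivity)
  have hMn := hM.pos n
  have e1 := hM.norm_dop_iterate_mul_le h12 hψ.1 hK.le hKψ.le (h1 j) (h2 j)
  have e2 := hM.norm_dop_iterate_mul_le (h12.mul hψ.1) hexpc (by positivity) (by norm_num) e1
    (h3 j) n
  refine e2.trans ?_
  rw [mul_assoc, mul_comm]
  gcongr

end Localization

section MainEstimate

open scoped FourierTransform

variable {d : ℕ} {M A : ℕ → ℝ} {K h C : ℝ} {φ ψ : Rd d → ℂ} {F : Rd d → Rd d → ℂ → ℂ}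

lemma M2star.exists_exp_mul_exp_neg_le (hM : IsWeightSeq M) (h : M2star M) (hK : 0 < K) :
    ∃ l D : ℝ, 0 < l ∧ 0 < D ∧ ∀ t, 0 ≤ t →
      Real.exp (l * (3 / 2) * nuA M t) * Real.exp (-nuA M (t / K)) ≤
        D * Real.exp (-(l * nuA M t)) := by
  obtain ⟨l, C, hl, h⟩ := h.le_nuA_div hM (le_max_right K 1)
  refine ⟨l / 3, Real.exp C, by positivity, Real.exp_pos _, fun t ht => ?_⟩
  rw [← Real.exp_add, ← Real.exp_add]
  refine Real.exp_le_exp.2 ?_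
  have h1 := h t ht
  have h2 : nuA M (t / max K 1) ≤ nuA M (t / K) :=
    hM.nuA_mono (by positivity) (by gcongr; exact le_max_left _ _)
  nlinarith [mul_nonneg hl.le (hM.nuA_nonneg ht)]

lemma integral_mul_cexp_I_mul (ρ : Rd d → ℂ) (v ξ : Rd d) (η : ℝ) :
    ∫ t, ρ t * Complex.exp (-(2 * Real.pi * Complex.I) *
      (((inner ℝ ξ t : ℝ) : ℂ) + (Complex.I * η) * ((inner ℝ v t : ℝ) : ℂ))) =
    𝓕 (fun y => ρ y * Complex.exp ((2 * Real.pi * η * inner ℝ v (y - 0) : ℝ) : ℂ)) ξ := by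
  rw [Real.fourier_eq']
  congr 1
  ext t
  rw [smul_eq_mul, mul_left_comm, ← Complex.exp_add, sub_zero, real_inner_comm]
  congr 2
  push_cast
  linear_combination (-(2 * Real.pi * η * (inner ℝ v t : ℂ))) * Complex.I_sq

lemma IsHolWeight.exists_localized_bound (hM : IsWeightSeq M) (hM2s : M2star M) (hM2 : M2 M)
    (hA : IsWeightSeq A) (hA2 : M2 A) (hfact : factSubset A) (hF : IsHolWeight M F)
    (hψ : KRou d M ψ) (hK : 0 < K) (hh : 0 < h) :
    ∃ l h₁ D : ℝ, 0 < l ∧ 0 < h₁ ∧ 0 ≤ D ∧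
    (∀ x : Rd d, Real.exp (nuA A (h₁ * ‖x‖)) ≤ D * Real.exp (1 / 2 * ‖x‖)) ∧
    ∀ (φ : Rd d → ℂ) (C : ℝ), GSBound M A K h C φ →
      HasMoments (fun ξ => Complex.exp (l * F 0 ξ 0) * 𝓕 φ ξ) ∧
      (∀ s y, ‖φ (y - s) * ψ y‖ ≤
        C * D * Real.exp (-nuA A (h₁ * ‖s‖)) * Real.exp (-(1 * ‖y‖))) ∧
      ∀ (s v : Rd d) (η : ℝ) (ξ : Rd d), ‖v‖ ≤ 1 → |η| ≤ 2 →
        ‖Complex.exp (l * F v ξ (Complex.I * η)) * ∫ t, φ (t - s) * ψ t *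
          Complex.exp (-(2 * Real.pi * Complex.I) *
          (((inner ℝ ξ t : ℝ) : ℂ) + (Complex.I * η) * ((inner ℝ v t : ℝ) : ℂ)))‖ ≤
        C * D * Real.exp (-nuA A (h₁ * ‖s‖)) * (1 + ‖ξ‖) ^ (-((d + 1 : ℕ) : ℝ)) := by
  obtain ⟨K₂, h₁, D, hK₂, hh₁, hD, hDexp, hloc⟩ :=
    GSBound.localized_bound (A := A) hM hA hfact hψ hK hh
  obtain ⟨l, D₂, hl, hD₂, hlD⟩ := hM2s.exists_exp_mul_exp_neg_le hM
    (K := max K₂ K * (d + 1)) (by positivity)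
  obtain ⟨C₅, hC₅, hP⟩ := hF.norm_cexp_le hl 2
  obtain ⟨C₆, hC₆, hw⟩ := hM2.exists_exp_neg_mul_nuA_le hM hl (d + 1)
  set J : ℝ := ∫ y : Rd d, Real.exp (-(1 * ‖y‖)) with hJ
  have hJ0 : 0 ≤ J := integral_nonneg fun y => (Real.exp_pos _).le
  have hPK : ∀ (k : ℝ), 0 < k → k ≤ max K₂ K → ∀ (v : Rd d) (η : ℝ) (ξ : Rd d), ‖v‖ ≤ 1 → |η| ≤ 2 →
      ‖Complex.exp (l * F v ξ (Complex.I * η))‖ * Real.exp (-nuA M (‖ξ‖ / (k * (d + 1)))) ≤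
        C₅ * D₂ * Real.exp (-(l * nuA M ‖ξ‖)) := by
    intro k hk hkK v η ξ hv hη
    have h2 : nuA M (‖ξ‖ / (max K₂ K * (d + 1))) ≤ nuA M (‖ξ‖ / (k * (d + 1))) :=
      hM.nuA_mono (by positivity) (by gcongr)
    calc _ ≤ (C₅ * Real.exp (l * (3 / 2) * nuA M ‖ξ‖)) *
          Real.exp (-nuA M (‖ξ‖ / (max K₂ K * (d + 1)))) :=
          mul_le_mul (hP v hv η ξ hη) (Real.exp_le_exp.2 (neg_le_neg h2)) (Real.exp_pos _).le
            (by positivity)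
      _ = C₅ * (Real.exp (l * (3 / 2) * nuA M ‖ξ‖) *
          Real.exp (-nuA M (‖ξ‖ / (max K₂ K * (d + 1))))) := by ring
      _ ≤ C₅ * (D₂ * Real.exp (-(l * nuA M ‖ξ‖))) :=
          mul_le_mul_of_nonneg_left (hlD _ (norm_nonneg ξ)) hC₅.le
      _ = _ := by ring
  set D' : ℝ := D + D * J * C₅ * D₂ * C₆ with hD'
  have hDD' : D ≤ D' := by
    have : 0 ≤ D * J * C₅ * D₂ * C₆ := by positivity
    linarith
  refine ⟨l, h₁, D', hl, hh₁, hD.trans hDD', fun x => (hDexp x).trans (by gcongr), ?_⟩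
  intro φ C hφ
  have hC := hφ.nonneg hA hM
  refine ⟨?_, fun s y => ?_, fun s v η ξ hv hη => ?_⟩
  · have hcont : Continuous (𝓕 φ) := (hφ.integrable hM hA hA2 hh).continuous_fourier
    set J' : ℝ := ∫ x : Rd d, Real.exp (-nuA A (h * ‖x‖)) with hJ'
    have hJ'0 : 0 ≤ J' := integral_nonneg fun y => (Real.exp_pos _).le
    refine hM2.hasMoments hM hl (((Complex.continuous_exp.comp
      (continuous_const.mul hF.continuous)).mul hcont).aestronglyMeasurable)
      (C := C * J' * (C₅ * D₂)) fun ξ => ?_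
    rw [norm_mul]
    have h3 := hPK K hK (le_max_right _ _) 0 0 ξ (by simp) (by simp)
    rw [Complex.ofReal_zero, mul_zero] at h3
    calc _ ≤ ‖Complex.exp (l * F 0 ξ 0)‖ *
          (C * J' * Real.exp (-nuA M (‖ξ‖ / (K * (d + 1))))) :=
          mul_le_mul_of_nonneg_left (hφ.norm_fourier_le hM hA hA2 hK hh ξ) (norm_nonneg _)
      _ = C * J' * (‖Complex.exp (l * F 0 ξ 0)‖ *
          Real.exp (-nuA M (‖ξ‖ / (K * (d + 1))))) := by ring
      _ ≤ C * J' * (C₅ * D₂ * Real.exp (-(l * nuA M ‖ξ‖))) :=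
          mul_le_mul_of_nonneg_left h3 (by positivity)
      _ = _ := by ring
  · have h3 := (hloc φ C hφ s 0 0 (by simp) (by simp) y).1
    simp only [mul_zero, zero_mul, Complex.ofReal_zero, Complex.exp_zero, mul_one] at h3
    refine h3.trans ?_
    gcongr
  · rw [integral_mul_cexp_I_mul (fun t => φ (t - s) * ψ t), norm_mul]
    set ω : ℝ := Real.exp (-nuA A (h₁ * ‖s‖)) with hω
    have hω0 : 0 < ω := Real.exp_pos _
    have hsm : ContDiff ℝ (⊤ : ℕ∞) fun y => φ (y - s) * ψ y *
        Complex.exp ((2 * Real.pi * η * inner ℝ v (y - 0) : ℝ) : ℂ) :=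
      ((hφ.1.comp (contDiff_id.sub contDiff_const)).mul hψ.1).mul
        (Complex.ofRealCLM.contDiff.comp (contDiff_const.mul
          (contDiff_const.inner ℝ (contDiff_id.sub contDiff_const)))).cexp
    have h4 := hM.norm_fourier_le hsm hK₂ ((integrable_exp_neg_norm one_pos).const_mul (C * D * ω))
      (fun y => (hloc φ C hφ s v η hv hη y).1) (fun j n y => (hloc φ C hφ s v η hv hη y).2 j n) ξ
    rw [integral_const_mul, ← hJ] at h4
    have h3 := hPK K₂ hK₂ (le_max_left _ _) v η ξ hv hη
    calc _ ≤ ‖Complex.exp (l * F v ξ (Complex.I * η))‖ *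
          (C * D * ω * J * Real.exp (-nuA M (‖ξ‖ / (K₂ * (d + 1))))) :=
          mul_le_mul_of_nonneg_left h4 (norm_nonneg _)
      _ = C * D * ω * J * (‖Complex.exp (l * F v ξ (Complex.I * η))‖ *
          Real.exp (-nuA M (‖ξ‖ / (K₂ * (d + 1))))) := by ring
      _ ≤ C * D * ω * J * (C₅ * D₂ * Real.exp (-(l * nuA M ‖ξ‖))) :=
          mul_le_mul_of_nonneg_left h3 (by positivity)
      _ ≤ C * D * ω * J * (C₅ * D₂ * (C₆ * (1 + ‖ξ‖) ^ (-((d + 1 : ℕ) : ℝ)))) := by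
          gcongr
          exact hw _ (norm_nonneg ξ)
      _ = C * (D * J * C₅ * D₂ * C₆) * ω * (1 + ‖ξ‖) ^ (-((d + 1 : ℕ) : ℝ)) := by ring
      _ ≤ _ := by
          gcongr
          rw [hD']
          linarith

/-- Localizing a Fourier multiplier. -/
lemma integral_mul_fourierInv_mul_fourier {P : Rd d → ℂ} {a b a' b' : Rd d → ℝ}
    (hφ : Continuous φ) (hψ : Continuous ψ) (hP : Continuous P)
    (ha : Integrable a) (hb : Integrable b) (ha' : Integrable a') (hb' : Integrable b')
    (h1 : ∀ s y, ‖φ (y - s) * ψ y‖ ≤ a s * b y)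
    (h2 : ∀ s ξ, ‖P ξ * 𝓕 (fun y => φ (y - s) * ψ y) ξ‖ ≤ a' s * b' ξ) (x : Rd d) :
    (∫ y, ψ y) * 𝓕⁻ (fun ξ => P ξ * 𝓕 φ ξ) x =
      ∫ s, 𝓕⁻ (fun ξ => P ξ * 𝓕 (fun y => φ (y - s) * ψ y) ξ) (x + s) := by
  set e : ℝ → ℂ := fun r => Complex.exp ((2 * Real.pi * r : ℝ) * Complex.I) with he
  have hec : Continuous e := by fun_prop
  have hen : ∀ r, ‖e r‖ = 1 := fun r => Complex.norm_exp_ofReal_mul_I _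
  have headd : ∀ r s, e (r + s) = e r * e s := fun r s => by
    simp only [he]
    rw [← Complex.exp_add]
    congr 1
    push_cast
    ring
  have hFt : ∀ (f : Rd d → ℂ) ξ, 𝓕 f ξ = ∫ y, e (-inner ℝ y ξ) * f y := fun f ξ => by
    rw [Real.fourier_eq']
    congr 1
    ext y
    simp only [he, smul_eq_mul]
    congr 4
    ring
  have hFi : ∀ (f : Rd d → ℂ) x, 𝓕⁻ f x = ∫ ξ, e (inner ℝ ξ x) * f ξ := fun f x => by
    rw [Real.fourierInv_eq']
    rfl
  have key : ∀ ξ, ∫ s, e (inner ℝ ξ s) * 𝓕 (fun y => φ (y - s) * ψ y) ξ = (∫ y, ψ y) * 𝓕 φ ξ := by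
    intro ξ
    have hsw : ∫ s, ∫ y, e (inner ℝ ξ s) * (e (-inner ℝ y ξ) * (φ (y - s) * ψ y)) =
        ∫ y, ∫ s, e (inner ℝ ξ s) * (e (-inner ℝ y ξ) * (φ (y - s) * ψ y)) := by
      refine integral_integral_swap ((ha.mul_prod hb).mono' (Continuous.aestronglyMeasurable ?_)
        (Eventually.of_forall fun p => ?_))
      · fun_prop
      · simp only [Function.uncurry]
        rw [norm_mul, norm_mul, hen, hen, one_mul, one_mul]
        exact h1 _ _
    calc _ = ∫ s, ∫ y, e (inner ℝ ξ s) * (e (-inner ℝ y ξ) * (φ (y - s) * ψ y)) := by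
          refine integral_congr_ae (Eventually.of_forall fun s => ?_)
          simp only [integral_const_mul, ← hFt]
      _ = ∫ y, ψ y * ∫ s, e (-inner ℝ (y - s) ξ) * φ (y - s) := by
          rw [hsw]
          congr 1
          ext y
          rw [← integral_const_mul]
          congr 1
          ext s
          have hin : -inner ℝ (y - s) ξ = inner ℝ ξ s + -inner ℝ y ξ := by
            rw [inner_sub_left, real_inner_comm s ξ]
            ring
          rw [hin, headd]
          ring
      _ = ∫ y, ψ y * 𝓕 φ ξ := by
          congr 1
          ext y
          rw [integral_sub_left_eq_self (fun s => e (-inner ℝ s ξ) * φ s), hFt]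
      _ = _ := integral_mul_const _ _
  have hmeas : StronglyMeasurable fun p : Rd d × Rd d =>
      𝓕 (fun y => φ (y - p.1) * ψ y) p.2 := by
    have : Continuous fun q : (Rd d × Rd d) × Rd d =>
        e (-inner ℝ q.2 q.1.2) * (φ (q.2 - q.1.1) * ψ q.2) := by fun_prop
    simp_rw [hFt]
    exact this.stronglyMeasurable.integral_prod_right'
  have hsw : ∫ s, ∫ ξ, e (inner ℝ ξ (x + s)) * (P ξ * 𝓕 (fun y => φ (y - s) * ψ y) ξ) =
      ∫ ξ, ∫ s, e (inner ℝ ξ (x + s)) * (P ξ * 𝓕 (fun y => φ (y - s) * ψ y) ξ) := by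
    refine integral_integral_swap ((ha'.mul_prod hb').mono'
      (((Continuous.aestronglyMeasurable ?_)).mul
        ((Continuous.aestronglyMeasurable ?_).mul hmeas.aestronglyMeasurable))
      (Eventually.of_forall fun p => ?_))
    · fun_prop
    · fun_prop
    · simp only [Function.uncurry]
      rw [norm_mul, hen, one_mul]
      exact h2 _ _
  simp_rw [hFi]
  rw [hsw, ← integral_const_mul]
  congr 1
  ext ξ
  calc _ = e (inner ℝ ξ x) * P ξ * ((∫ y, ψ y) * 𝓕 φ ξ) := by ring
    _ = _ := by
      rw [← key, ← integral_const_mul]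
      congr 1
      ext s
      rw [inner_add_right, headd]
      ring

lemma KRou.integrable_exp_mul_mul (hM : IsWeightSeq M) (hψ : KRou d M ψ) {f : Rd d → ℂ}
    (hf : Continuous f) (hb : ∀ x, ‖f x‖ ≤ C) (r : ℝ) :
    Integrable fun t => Real.exp (r * ‖t‖) * ‖f t * ψ t‖ := by
  obtain ⟨K, hK, h⟩ := hψ.exists_norm_le hM
  obtain ⟨n, hn⟩ := exists_nat_ge (r + 1)
  obtain ⟨C₁, hC₁, h1⟩ := h n
  have hC : 0 ≤ C := (norm_nonneg _).trans (hb 0)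
  have hψc := hψ.1.continuous
  refine ((integrable_exp_neg_norm one_pos).const_mul (C * C₁)).mono'
    (Continuous.aestronglyMeasurable (by fun_prop)) (Eventually.of_forall fun t => ?_)
  have h2 : ‖ψ t‖ ≤ C₁ * Real.exp (-(n * ‖t‖)) := by simpa [hM.2.1] using h1 0 t
  rw [Real.norm_of_nonneg (by positivity), norm_mul]
  calc _ ≤ Real.exp (r * ‖t‖) * (C * (C₁ * Real.exp (-(n * ‖t‖)))) := by
        gcongr
        exact hb t
    _ = C * C₁ * Real.exp (r * ‖t‖ + -(n * ‖t‖)) := by rw [Real.exp_add]; ring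
    _ ≤ _ := by
        gcongr
        nlinarith [norm_nonneg t]

/-- The inverse Fourier multiplier with symbol `exp (l F)` preserves decay. -/
theorem IsHolWeight.exists_multiplier_bound (hM : IsWeightSeq M) (hM2s : M2star M) (hM2 : M2 M)
    (hA : IsWeightSeq A) (hA2 : M2 A) (hfact : factSubset A) (hF : IsHolWeight M F)
    (hK : 0 < K) (hh : 0 < h) :
    ∃ l h' D : ℝ, 0 < l ∧ 0 < h' ∧ 0 ≤ D ∧
    ∀ (φ : Rd d → ℂ) (C : ℝ), GSBound M A K h C φ →
      HasMoments (fun ξ => Complex.exp (l * F 0 ξ 0) * 𝓕 φ ξ) ∧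
      ∀ x, ‖𝓕⁻ (fun ξ => Complex.exp (l * F 0 ξ 0) * 𝓕 φ ξ) x‖ ≤
        C * D * Real.exp (-nuA A (h' * ‖x‖)) := by
  set ψ : Rd d → ℂ := 𝓕⁻ fun ξ => Complex.exp (-((1:ℝ) : ℂ) * F 0 ξ 0) with hψdef
  have hψ : KRou d M ψ := hF.kRou hM hM2 one_pos
  have hψc := hψ.1.continuous
  have hc₁ : ∫ y, ψ y ≠ 0 := by
    have h0 : 𝓕 ψ 0 = ∫ y, ψ y := by
      rw [Real.fourier_eq']
      simp
    rw [← h0, hψdef, hF.fourier_kernel hM hM2 one_pos]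
    exact Complex.exp_ne_zero _
  set c₁ : ℝ := ‖∫ y, ψ y‖ with hc₁def
  have hc₁pos : 0 < c₁ := norm_pos_iff.2 hc₁
  obtain ⟨l, h₁, D, hl, hh₁, hD, hDexp, hloc⟩ :=
    hF.exists_localized_bound hM hM2s hM2 hA hA2 hfact hψ hK hh
  set J : ℝ := ∫ ξ : Rd d, (1 + ‖ξ‖) ^ (-((d + 1 : ℕ) : ℝ)) with hJ
  have hJ0 : 0 ≤ J := integral_nonneg fun ξ => by positivity
  set I₁ : ℝ := ∫ s : Rd d, Real.exp (-(1 / 2 * ‖s‖)) with hI₁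
  have hI₁0 : 0 ≤ I₁ := integral_nonneg fun ξ => (Real.exp_pos _).le
  refine ⟨l, h₁ / 2, D * J * D * I₁ / c₁, hl, half_pos hh₁, by positivity, fun φ C hφ => ?_⟩
  obtain ⟨hmom, hb1, hb2⟩ := hloc φ C hφ
  refine ⟨hmom, fun x => ?_⟩
  have hC := hφ.nonneg hA hM
  have hφc := hφ.1.continuous
  have hzero : ∀ s v ξ, ∫ t, φ (t - s) * ψ t * Complex.exp (-(2 * Real.pi * Complex.I) *
      (((inner ℝ ξ t : ℝ) : ℂ) + 0 * ((inner ℝ v t : ℝ) : ℂ))) =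
      𝓕 (fun y => φ (y - s) * ψ y) ξ := fun s v ξ => by
    have := integral_mul_cexp_I_mul (fun t => φ (t - s) * ψ t) v ξ 0
    simpa using this
  have hω : Integrable fun s : Rd d => C * D * Real.exp (-nuA A (h₁ * ‖s‖)) :=
    (hA2.integrable_exp_neg_nuA hA hh₁).const_mul _
  have h2 : ∀ s ξ, ‖Complex.exp (l * F 0 ξ 0) * 𝓕 (fun y => φ (y - s) * ψ y) ξ‖ ≤
      C * D * Real.exp (-nuA A (h₁ * ‖s‖)) * (1 + ‖ξ‖) ^ (-((d + 1 : ℕ) : ℝ)) := fun s ξ => by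
    have := hb2 s 0 0 ξ (by simp) (by simp)
    rw [Complex.ofReal_zero, mul_zero, hzero] at this
    exact this
  have hpt : ∀ s z, ‖𝓕⁻ (fun ξ => Complex.exp (l * F 0 ξ 0) *
      𝓕 (fun y => φ (y - s) * ψ y) ξ) z‖ ≤
      C * D * Real.exp (-nuA A (h₁ * ‖s‖)) * J * Real.exp (-‖z‖) := by
    intro s z
    have hφs : Continuous fun t => φ (t - s) := hφc.comp (continuous_id.sub continuous_const)
    have hφsb : ∀ t, ‖φ (t - s)‖ ≤ C := fun t => (hφ.norm_le hM _).trans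
      (mul_le_of_le_one_right hC (Real.exp_le_one_iff.2
        (neg_nonpos.2 (hA.nuA_nonneg (by positivity)))))
    have hv : ‖‖z‖⁻¹ • z‖ ≤ 1 := by
      rw [norm_smul, norm_inv, norm_norm]
      exact inv_mul_le_one
    have hE : EntireAlong (‖z‖⁻¹ • z) fun ξ ζ => Complex.exp (l * F (‖z‖⁻¹ • z) ξ ζ) *
        ∫ t, φ (t - s) * ψ t * Complex.exp (-(2 * Real.pi * Complex.I) *
          (((inner ℝ ξ t : ℝ) : ℂ) + ζ * ((inner ℝ (‖z‖⁻¹ • z) t : ℝ) : ℂ))) :=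
      ((hF.entireAlong _).const_mul _).cexp.mul (EntireAlong.laplace
        (hφs.mul hψc).aestronglyMeasurable (hψ.integrable_exp_mul_mul hM hφs hφsb) _)
    have := hE.norm_fourierInv_le (R := 2) (C := C * D * Real.exp (-nuA A (h₁ * ‖s‖)))
      (fun η ξ hη => hb2 s _ η ξ hv hη) (η := 1) (by norm_num)
    simp only [hzero, hF.zero] at this
    refine this.trans ?_
    gcongr
    nlinarith [Real.pi_gt_three, norm_nonneg z]
  have hid := integral_mul_fourierInv_mul_fourier (P := fun ξ => Complex.exp (l * F 0 ξ 0))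
    hφc hψc (Complex.continuous_exp.comp (continuous_const.mul hF.continuous)) hω
    (integrable_exp_neg_norm one_pos) hω (integrable_one_add_norm_rpow d) hb1 h2 x
  have hle : c₁ * ‖𝓕⁻ (fun ξ => Complex.exp (l * F 0 ξ 0) * 𝓕 φ ξ) x‖ ≤
      C * (D * J * D * I₁) * Real.exp (-nuA A (h₁ / 2 * ‖x‖)) := by
    rw [hc₁def, ← norm_mul, hid]
    have h_int : Integrable fun s : Rd d => Real.exp (-(1 / 2 * ‖x + s‖)) :=
      (integrable_exp_neg_norm (d := d) (one_half_pos (α := ℝ))).comp_add_left x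
    have hI : ∫ s : Rd d, Real.exp (-(1 / 2 * ‖x + s‖)) = I₁ :=
      integral_add_left_eq_self (fun s : Rd d => Real.exp (-(1 / 2 * ‖s‖))) x
    calc _ ≤ ∫ s : Rd d, C * (D * J * D) * Real.exp (-nuA A (h₁ / 2 * ‖x‖)) *
          Real.exp (-(1 / 2 * ‖x + s‖)) := by
          refine norm_integral_le_of_norm_le (h_int.const_mul _)
            (Eventually.of_forall fun s => (hpt s (x + s)).trans ?_)
          have h3 := hA.exp_neg_nuA_mul_le hh₁.le x (-s)
          rw [norm_neg, sub_neg_eq_add] at h3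
          calc _ ≤ C * D * (D * Real.exp (1 / 2 * ‖x + s‖) *
                Real.exp (-nuA A (h₁ / 2 * ‖x‖))) * J * Real.exp (-‖x + s‖) := by
                gcongr
                exact h3.trans (by gcongr; exact hDexp _)
            _ = C * (D * J * D) * Real.exp (-nuA A (h₁ / 2 * ‖x‖)) *
                Real.exp (1 / 2 * ‖x + s‖ + -‖x + s‖) := by rw [Real.exp_add]; ring
            _ = _ := by
                congr 2
                ring
      _ = _ := by
          rw [integral_const_mul, hI]
          ring
  calc _ ≤ C * (D * J * D * I₁) * Real.exp (-nuA A (h₁ / 2 * ‖x‖)) / c₁ := by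
        rw [le_div_iff₀ hc₁pos, mul_comm]
        exact hle
    _ = _ := by ring

end MainEstimate

section Factorization

open scoped FourierTransform

variable {d : ℕ} {M A : ℕ → ℝ} {K h C : ℝ} {φ ψ χ : Rd d → ℂ} {F : Rd d → Rd d → ℂ → ℂ}

lemma fourier_pD (hφ : ContDiff ℝ (⊤ : ℕ∞) φ) (hi : ∀ α, Integrable (pD α φ)) (α : Fin d → ℕ)
    (ξ : Rd d) :
    𝓕 (pD α φ) ξ = (∏ j, (2 * Real.pi * Complex.I * (ξ j : ℂ)) ^ α j) * 𝓕 φ ξ := by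
  induction α using multiindex_induction with
  | h0 => simp [pD_zero]
  | hs α j ih =>
    have hd := pD_add_single hφ α j
    rw [hd, fourier_dop (contDiff_pD hφ α) j (hi α) (hd ▸ hi _), ih]
    simp only [Pi.add_apply, pow_add, Finset.prod_mul_distrib]
    rw [Finset.prod_eq_single_of_mem (f := fun i => (2 * Real.pi * Complex.I * (ξ i : ℂ)) ^
      (Pi.single j 1 : Fin d → ℕ) i) j (Finset.mem_univ j)
      (fun i _ hij => by simp [Pi.single_eq_of_ne hij])]
    simp only [Pi.single_eq_same, pow_one]
    ring

lemma HasMoments.bdd_mul {f g : Rd d → ℂ} (hg : HasMoments g) (hf : Continuous f)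
    (hb : ∀ ξ, ‖f ξ‖ ≤ C) : HasMoments fun ξ => f ξ * g ξ := by
  have hm : AEStronglyMeasurable fun ξ => f ξ * g ξ := hf.aestronglyMeasurable.mul hg.1
  refine ⟨hm, fun n => ((hg.2 n).const_mul C).mono' ?_ (Eventually.of_forall fun ξ => ?_)⟩
  · exact (continuous_norm.pow n).aestronglyMeasurable.mul hm.norm
  · rw [Real.norm_of_nonneg (by positivity), norm_mul]
    calc _ = ‖f ξ‖ * (‖ξ‖ ^ n * ‖g ξ‖) := by ring
      _ ≤ _ := by
        gcongr
        exact hb ξ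

namespace GSBound

lemma integrable_pD (hM : IsWeightSeq M) (hM2 : M2 M) (hA : IsWeightSeq A) (hA2 : M2 A)
    (hK : 0 ≤ K) (hh : 0 < h) (hφ : GSBound M A K h C φ) (α : Fin d → ℕ) :
    Integrable (_root_.pD α φ) := by
  obtain ⟨C₀, H, h2⟩ := hM2
  exact (hφ.pD hM hA h2 hK α).integrable hM hA hA2 hh

lemma hasMoments_fourier (hM : IsWeightSeq M) (hM2 : M2 M) (hA : IsWeightSeq A) (hA2 : M2 A)
    (hK : 0 < K) (hh : 0 < h) (hφ : GSBound M A K h C φ) : HasMoments (𝓕 φ) := by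
  have hc := (hφ.integrable hM hA hA2 hh).continuous_fourier
  refine ⟨hc.aestronglyMeasurable, fun n => ?_⟩
  obtain ⟨D, hD, h1⟩ := hM2.exp_neg_nuA_le (d := d) hM (h := (K * (d + 1))⁻¹)
    (by positivity) (n + (d + 1))
  set J : ℝ := ∫ x : Rd d, Real.exp (-nuA A (h * ‖x‖)) with hJ
  have hJ0 : 0 ≤ J := integral_nonneg fun x => (Real.exp_pos _).le
  have hC := hφ.nonneg hA hM
  refine ((integrable_one_add_norm_rpow d).const_mul (C * J * D)).mono'
    (((continuous_norm.pow n).mul hc.norm).aestronglyMeasurable)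
    (Eventually.of_forall fun ξ => ?_)
  rw [Real.norm_of_nonneg (by positivity)]
  have h3 := hφ.norm_fourier_le hM hA hA2 hK hh ξ
  rw [div_eq_inv_mul] at h3
  have h4 : (1 + ‖ξ‖) ^ n * (1 + ‖ξ‖) ^ (-((n + (d + 1) : ℕ) : ℝ)) =
      (1 + ‖ξ‖) ^ (-((d + 1 : ℕ) : ℝ)) := by
    rw [← Real.rpow_natCast, ← Real.rpow_add (by positivity)]
    congr 1
    push_cast
    ring
  calc _ ≤ (1 + ‖ξ‖) ^ n * (C * J * (D * (1 + ‖ξ‖) ^ (-((n + (d + 1) : ℕ) : ℝ)))) := by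
        gcongr
        · linarith
        · exact h3.trans (by gcongr; exact h1 ξ)
    _ = C * J * D * ((1 + ‖ξ‖) ^ n * (1 + ‖ξ‖) ^ (-((n + (d + 1) : ℕ) : ℝ))) := by ring
    _ = _ := by rw [h4]

lemma fourierInv_fourier (hM : IsWeightSeq M) (hM2 : M2 M) (hA : IsWeightSeq A) (hA2 : M2 A)
    (hK : 0 < K) (hh : 0 < h) (hφ : GSBound M A K h C φ) : 𝓕⁻ (𝓕 φ) = φ :=
  Continuous.fourierInv_fourier_eq hφ.1.continuous (hφ.integrable hM hA hA2 hh)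
    (hφ.hasMoments_fourier hM hM2 hA hA2 hK hh).integrable

lemma pD_convF (hM : IsWeightSeq M) (hM2 : M2 M) (hA : IsWeightSeq A) (hA2 : M2 A)
    (hK : 0 < K) (hh : 0 < h) (hψ : Integrable ψ) (hχ : GSBound M A K h C χ) :
    ContDiff ℝ (⊤ : ℕ∞) (convF ψ χ) ∧
      ∀ α, _root_.pD α (convF ψ χ) = convF ψ (_root_.pD α χ) := by
  obtain ⟨C₀, H, h2⟩ := id hM2
  have hH : 0 < H := zero_lt_one.trans_le h2.2.1
  have hmom : HasMoments fun ξ => 𝓕 ψ ξ * 𝓕 χ ξ :=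
    (hχ.hasMoments_fourier hM hM2 hA hA2 hK hh).bdd_mul hψ.continuous_fourier
      (_root_.norm_fourier_le ψ)
  have heq : ∀ {K' C' : ℝ} {χ' : Rd d → ℂ}, 0 < K' → GSBound M A K' h C' χ' →
      convF ψ χ' = 𝓕⁻ fun ξ => 𝓕 ψ ξ * 𝓕 χ' ξ := by
    intro K' C' χ' hK' hχ'
    rw [← convF_fourierInv hψ (hχ'.hasMoments_fourier hM hM2 hA hA2 hK' hh).integrable,
      hχ'.fourierInv_fourier hM hM2 hA hA2 hK' hh]
  refine ⟨heq hK hχ ▸ hmom.contDiff_fourierInv, fun α => ?_⟩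
  rw [heq hK hχ, heq (by positivity) (hχ.pD hM hA h2 hK.le α), hmom.pD_fourierInv]
  congr 1
  ext ξ
  rw [fourier_pD hχ.1 (hχ.integrable_pD hM hM2 hA hA2 hK.le hh)]
  ring

/-- Convolutions of functions with Gelfand–Shilov bounds satisfy such bounds. -/
lemma convF (hM : IsWeightSeq M) (hM2 : M2 M) (hA : IsWeightSeq A) (hA2 : M2 A)
    {K' h' C' : ℝ} (hh' : 0 < h') (hψ : GSBound M A K' h' C' ψ)
    (hK : 0 < K) (hh : 0 < h) (hχ : GSBound M A K h C χ) :
    ∃ k D : ℝ, 0 < k ∧ GSBound M A K k D (convF ψ χ) := by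
  obtain ⟨C₀, H, h2⟩ := id hA2
  have hH : 0 < H := zero_lt_one.trans_le h2.2.1
  have hC₀ : 0 < C₀ := zero_lt_one.trans_le h2.1
  obtain ⟨hsm, hpD⟩ := pD_convF hM hM2 hA hA2 hK hh (hψ.integrable hM hA hA2 hh') hχ
  set k : ℝ := min h (h' / H) with hk
  have hk0 : 0 < k := lt_min hh (by positivity)
  set J : ℝ := ∫ t : Rd d, Real.exp (-nuA A (k * ‖t‖)) with hJ
  refine ⟨k / 2, C' * C * C₀ * J, half_pos hk0, hsm, fun α x => ?_⟩
  have hC := hχ.nonneg hA hM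
  have hC' := hψ.nonneg hA hM
  have hMp := hM.pos (msize α)
  rw [hpD]
  have hkey : ∀ t : Rd d, Real.exp (-nuA A (h' * ‖t‖)) * Real.exp (nuA A (k * ‖t‖)) ≤
      C₀ * Real.exp (-nuA A (k * ‖t‖)) := by
    intro t
    have h3 := h2.two_mul_nuA_le hA (t := k * ‖t‖) (by positivity)
    have h4 : nuA A (H * (k * ‖t‖)) ≤ nuA A (h' * ‖t‖) := by
      refine hA.nuA_mono (by positivity) ?_
      rw [← mul_assoc]
      gcongr
      calc _ ≤ H * (h' / H) := by gcongr; exact min_le_right _ _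
        _ = _ := by field_simp
    rw [← Real.exp_add, ← Real.exp_log hC₀, ← Real.exp_add]
    exact Real.exp_le_exp.2 (by linarith)
  calc _ ≤ ∫ t, C' * C * C₀ * K ^ msize α * M (msize α) * Real.exp (-nuA A (k / 2 * ‖x‖)) *
        Real.exp (-nuA A (k * ‖t‖)) := by
        refine norm_integral_le_of_norm_le ((hA2.integrable_exp_neg_nuA hA hk0).const_mul _)
          (Eventually.of_forall fun t => ?_)
        rw [norm_mul]
        have h5 := hA.exp_neg_nuA_mul_le hk0.le x (x - t)
        rw [sub_sub_cancel] at h5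
        calc _ ≤ (C' * Real.exp (-nuA A (h' * ‖t‖))) *
              (C * K ^ msize α * M (msize α) *
                (Real.exp (nuA A (k * ‖t‖)) * Real.exp (-nuA A (k / 2 * ‖x‖)))) := by
              gcongr
              · exact hψ.norm_le hM t
              · refine ((hχ.mono_weight hM hA hK.le hk0.le (min_le_left _ _)).2 α _).trans ?_
                gcongr
          _ = C' * C * K ^ msize α * M (msize α) * Real.exp (-nuA A (k / 2 * ‖x‖)) *
              (Real.exp (-nuA A (h' * ‖t‖)) * Real.exp (nuA A (k * ‖t‖))) := by ring
          _ ≤ C' * C * K ^ msize α * M (msize α) * Real.exp (-nuA A (k / 2 * ‖x‖)) *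
              (C₀ * Real.exp (-nuA A (k * ‖t‖))) :=
              mul_le_mul_of_nonneg_left (hkey t) (by positivity)
          _ = _ := by ring
    _ = _ := by
        rw [integral_const_mul]
        ring

lemma of_le (hφ : ContDiff ℝ (⊤ : ℕ∞) φ) (hh : 0 < h)
    (hb : ∀ (α : Fin d → ℕ) (x : Rd d),
      h ^ msize α * ‖_root_.pD α φ x‖ * Real.exp (nuA A (h * ‖x‖)) ≤ C * M (msize α)) :
    GSBound M A h⁻¹ h C φ := by
  refine ⟨hφ, fun α x => ?_⟩
  have h1 := hb α x
  rw [Real.exp_neg, ← div_eq_mul_inv, le_div_iff₀ (Real.exp_pos _), inv_pow,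
    mul_right_comm C, ← div_eq_mul_inv, le_div_iff₀ (by positivity)]
  linarith

lemma mul_norm_mul_exp_le (hM : IsWeightSeq M) (hA : IsWeightSeq A) (hK : 0 < K) (hh : 0 < h)
    (hφ : GSBound M A K h C φ) (α : Fin d → ℕ) (x : Rd d) :
    min h K⁻¹ ^ msize α * ‖_root_.pD α φ x‖ * Real.exp (nuA A (min h K⁻¹ * ‖x‖)) ≤
      C * M (msize α) := by
  have hC := hφ.nonneg hA hM
  have hk : 0 < min h K⁻¹ := lt_min hh (inv_pos.2 hK)
  have hMp := hM.pos (msize α)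
  calc _ ≤ K⁻¹ ^ msize α * (C * K ^ msize α * M (msize α) * Real.exp (-nuA A (h * ‖x‖))) *
        Real.exp (nuA A (h * ‖x‖)) := by
        gcongr
        · exact min_le_right _ _
        · exact hφ.2 α x
        · refine hA.nuA_mono (by positivity) ?_
          gcongr
          exact min_le_left _ _
    _ = (K⁻¹ * K) ^ msize α * (C * M (msize α)) *
        Real.exp (-nuA A (h * ‖x‖) + nuA A (h * ‖x‖)) := by
        rw [mul_pow, Real.exp_add]
        ring
    _ = _ := by simp [inv_mul_cancel₀ hK.ne']

lemma gsRou (hM : IsWeightSeq M) (hA : IsWeightSeq A) (hK : 0 < K) (hh : 0 < h)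
    (hφ : GSBound M A K h C φ) : GSRou d M A φ :=
  ⟨hφ.1, _, lt_min hh (inv_pos.2 hK), C, hφ.mul_norm_mul_exp_le hM hA hK hh⟩

end GSBound

lemma GSRou.exists_gsBound (hφ : GSRou d M A φ) :
    ∃ K h C : ℝ, 0 < K ∧ 0 < h ∧ GSBound M A K h C φ := by
  obtain ⟨hsm, h, hh, C, hb⟩ := hφ
  exact ⟨h⁻¹, h, C, inv_pos.2 hh, hh, .of_le hsm hh hb⟩

lemma KRou.gsRou (hM : IsWeightSeq M) (hA : IsWeightSeq A) (hfact : factSubset A)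
    (hφ : KRou d M φ) : GSRou d M A φ := by
  obtain ⟨K, hK, hb⟩ := hφ.exists_norm_le hM
  obtain ⟨C₁, L, hC₁, hL, hexp⟩ := hfact.exp_nuA_le hA
  obtain ⟨n, hn⟩ := exists_nat_ge L
  obtain ⟨C, hC, hb⟩ := hb n
  refine GSBound.gsRou (C := C * C₁) hM hA hK one_pos ⟨hφ.1, fun α x => (hb α x).trans ?_⟩
  have hMp := hM.pos (msize α)
  have h1 : Real.exp (-(n * ‖x‖)) ≤ C₁ * Real.exp (-nuA A (1 * ‖x‖)) := by
    rw [Real.exp_neg (nuA A _), ← div_eq_mul_inv, le_div_iff₀ (Real.exp_pos _), one_mul]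
    calc _ ≤ Real.exp (-(n * ‖x‖)) * (C₁ * Real.exp (L * ‖x‖)) := by
          gcongr
          exact hexp _ (norm_nonneg x)
      _ = C₁ * Real.exp (-(n * ‖x‖) + L * ‖x‖) := by rw [Real.exp_add]; ring
      _ ≤ C₁ * 1 := by
          gcongr
          rw [Real.exp_le_one_iff]
          nlinarith [norm_nonneg x]
      _ = C₁ := mul_one _
  calc _ ≤ C * K ^ msize α * M (msize α) * (C₁ * Real.exp (-nuA A (1 * ‖x‖))) := by gcongr
    _ = _ := by ring

lemma GSRou.convF (hM : IsWeightSeq M) (hM2 : M2 M) (hA : IsWeightSeq A) (hA2 : M2 A)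
    (hψ : GSRou d M A ψ) (hχ : GSRou d M A χ) : GSRou d M A (convF ψ χ) := by
  obtain ⟨K', h', C', hK', hh', hψ⟩ := hψ.exists_gsBound
  obtain ⟨K, h, C, hK, hh, hχ⟩ := hχ.exists_gsBound
  obtain ⟨k, D, hk, hb⟩ := hψ.convF hM hM2 hA hA2 hh' hK hh hχ
  exact hb.gsRou hM hA hK hk

/-- Uniform factorization. -/
theorem GSBound.exists_factorization (d : ℕ) (hM : IsWeightSeq M) (hM2s : M2star M) (hM2 : M2 M)
    (hA : IsWeightSeq A) (hA2 : M2 A) (hfact : factSubset A) (hK : 0 < K) (hh : 0 < h) :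
    ∃ ψ : Rd d → ℂ, KRou d M ψ ∧ ∃ (T : (Rd d → ℂ) → Rd d → ℂ) (K' h' D : ℝ), 0 < K' ∧ 0 < h' ∧
      ∀ φ C, GSBound M A K h C φ →
        GSBound M A K' h' (C * D) (T φ) ∧ _root_.convF ψ (T φ) = φ := by
  obtain ⟨F, hF⟩ := hM2s.exists_isHolWeight d hM
  obtain ⟨C₀, H, h2⟩ := id hM2
  have hH : 0 < H := zero_lt_one.trans_le h2.2.1
  have hC₀ : 0 < C₀ := zero_lt_one.trans_le h2.1
  obtain ⟨l, h', D, hl, hh', hD, hT⟩ :=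
    hF.exists_multiplier_bound (K := K * H) hM hM2s hM2 hA hA2 hfact (by positivity) hh
  refine ⟨𝓕⁻ fun ξ => Complex.exp (-(l : ℂ) * F 0 ξ 0), hF.kRou hM hM2 hl,
    fun φ => 𝓕⁻ fun ξ => Complex.exp (l * F 0 ξ 0) * 𝓕 φ ξ, K * H, h', C₀ * D,
    by positivity, hh', fun φ C hφ => ?_⟩
  have hmom : HasMoments fun ξ => Complex.exp (l * F 0 ξ 0) * 𝓕 φ ξ := by
    simpa only [pD_zero] using (hT _ _ (hφ.pD hM hA h2 hK.le 0)).1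
  refine ⟨⟨hmom.contDiff_fourierInv, fun α x => ?_⟩, ?_⟩
  · have e : (fun ξ : Rd d => (∏ j, (2 * Real.pi * Complex.I * (ξ j : ℂ)) ^ α j) *
        (Complex.exp (l * F 0 ξ 0) * 𝓕 φ ξ)) =
        fun ξ => Complex.exp (l * F 0 ξ 0) * 𝓕 (_root_.pD α φ) ξ := by
      ext ξ
      rw [fourier_pD hφ.1 (hφ.integrable_pD hM hM2 hA hA2 hK.le hh)]
      ring
    rw [hmom.pD_fourierInv, e]
    refine ((hT _ _ (hφ.pD hM hA h2 hK.le α)).2 x).trans (le_of_eq ?_)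
    ring
  · rw [convF_fourierInv ((hF.kRou hM hM2 hl).integrable hM) hmom.integrable,
      hF.fourier_kernel hM hM2 hl]
    conv_rhs => rw [← hφ.fourierInv_fourier hM hM2 hA hA2 hK hh]
    congr 1
    ext ξ
    rw [← mul_assoc, ← Complex.exp_add]
    simp

/-- Bounded sets factor uniformly. -/
theorem GSRouBdd.exists_factorization {B : Set (Rd d → ℂ)} (hM : IsWeightSeq M) (hM2s : M2star M)
    (hM2 : M2 M) (hA : IsWeightSeq A) (hA2 : M2 A) (hfact : factSubset A)
    (hB : GSRouBdd d M A B) :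
    ∃ ψ : Rd d → ℂ, KRou d M ψ ∧
      ∃ A' : Set (Rd d → ℂ), GSRouBdd d M A A' ∧ (fun χ => convF ψ χ) '' A' = B := by
  obtain ⟨hBS, h, hh, C, hb⟩ := hB
  have hbd : ∀ φ ∈ B, GSBound M A h⁻¹ h C φ := fun φ hφ => .of_le (hBS φ hφ).1 hh (hb φ hφ)
  obtain ⟨ψ, hψ, T, K', h', D, hK', hh', hT⟩ :=
    GSBound.exists_factorization d hM hM2s hM2 hA hA2 hfact (inv_pos.2 hh) hh
  refine ⟨ψ, hψ, T '' B, ⟨?_, min h' K'⁻¹, lt_min hh' (inv_pos.2 hK'), C * D, ?_⟩, ?_⟩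
  · rintro _ ⟨φ, hφ, rfl⟩
    exact (hT φ C (hbd φ hφ)).1.gsRou hM hA hK' hh'
  · rintro _ ⟨φ, hφ, rfl⟩
    exact (hT φ C (hbd φ hφ)).1.mul_norm_mul_exp_le hM hA hK' hh'
  · rw [Set.image_image]
    exact (Set.image_congr fun φ hφ => (hT φ C (hbd φ hφ)).2).trans (Set.image_id' B)

end Factorization

/-- Strong factorization for Gelfand–Shilov spaces of Roumieu type (Corollary 7.6). -/
theorem stmt15 (d : ℕ) (M A : ℕ → ℝ)
    (hM : IsWeightSeq M) (hM2 : M2 M) (h2s : M2star M)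
    (hA : IsWeightSeq A) (hA2 : M2 A) (hfact : factSubset A) :
    convSet {f | KRou d M f} {f | GSRou d M A f} = {f | GSRou d M A f} ∧
    convSet {f | GSRou d M A f} {f | GSRou d M A f} = {f | GSRou d M A f} ∧
    ∀ B : Set (Rd d → ℂ), GSRouBdd d M A B →
      ∃ ψ : Rd d → ℂ, KRou d M ψ ∧
        ∃ A' : Set (Rd d → ℂ), GSRouBdd d M A A' ∧ (fun χ => convF ψ χ) '' A' = B := by
  have hfac : ∀ f, GSRou d M A f → ∃ ψ, KRou d M ψ ∧ ∃ χ, GSRou d M A χ ∧ f = convF ψ χ := by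
    intro f hf
    obtain ⟨K, h, C, hK, hh, hb⟩ := hf.exists_gsBound
    obtain ⟨ψ, hψ, T, K', h', D, hK', hh', hT⟩ :=
      GSBound.exists_factorization d hM h2s hM2 hA hA2 hfact hK hh
    exact ⟨ψ, hψ, T f, (hT f C hb).1.gsRou hM hA hK' hh', (hT f C hb).2.symm⟩
  refine ⟨Set.Subset.antisymm ?_ ?_, Set.Subset.antisymm ?_ ?_,
    fun B hB => hB.exists_factorization hM h2s hM2 hA hA2 hfact⟩
  · rintro _ ⟨ψ, hψ, χ, hχ, rfl⟩
    exact (KRou.gsRou hM hA hfact hψ).convF hM hM2 hA hA2 hχ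
  · intro f hf
    obtain ⟨ψ, hψ, χ, hχ, h⟩ := hfac f hf
    exact ⟨ψ, hψ, χ, hχ, h⟩
  · rintro _ ⟨ψ, hψ, χ, hχ, rfl⟩
    exact GSRou.convF hM hM2 hA hA2 hψ hχ
  · intro f hf
    obtain ⟨ψ, hψ, χ, hχ, h⟩ := hfac f hf
    exact ⟨ψ, KRou.gsRou hM hA hfact hψ, χ, hχ, h⟩
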